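/- Let S be a closed surface with a fixed metric inducing its topology and let K be a nonempty compact subset of S. Then D_K = {[x]_∼ : x ∈ K}, the collection of classes of the Schönflies equivalence ∼_K, is an upper semicontinuous decomposition of K into subcontinua; in particular, every class [x]_∼ is a nonempty compact connected subset of K. -/

import Mathlib

open Set Metric Filter Topology unitInterval

/-- A space is locally euclidean of dimension 2 if every point has an open neighborhood
homeomorphic to `ℝ²`. A *closed surface* is a nonempty compact connected Hausdorff space
with this property. -/
def IsSurfaceLocallyEuclidean (S : Type*) [TopologicalSpace S] : Prop :=
  ∀ x : S, ∃ U : Set S, IsOpen U ∧ x ∈ U ∧ Nonempty (U ≃ₜ (ℝ × ℝ))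

/-- The Schönflies relation of a compact set `K` on a (metric) surface `S`: pairs `(x, x)`
with `x ∈ K`, together with pairs of distinct points `x, y ∈ K` for which there is a
topological embedding `φ` of the square `[0,1]²` into `S` (a marked quadrilateral with
marked sides `I₁ = φ([0,1]×{0})` and `I₂ = φ([0,1]×{1})`) such that
(a) `x ∈ I₁`, `y ∈ I₂` and `K ∩ ∂Q ⊆ I₁ ∪ I₂`;
(b) `K ∩ Q` has infinitely many pairwise distinct connected components `Qₙ`, each meeting
both `I₁` and `I₂`;
(c) the sequence `(Qₙ)` converges in the Hausdorff metric to a continuum `Q∞` containing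
both `x` and `y`. -/
def schonfliesRel {S : Type*} [MetricSpace S] (K : Set S) : Set (S × S) :=
  {p | p.1 ∈ K ∧ p.2 ∈ K ∧ (p.1 = p.2 ∨
    ∃ φ : unitInterval × unitInterval → S, Topology.IsEmbedding φ ∧
      p.1 ∈ φ '' {q | q.2 = 0} ∧ p.2 ∈ φ '' {q | q.2 = 1} ∧
      K ∩ (φ '' {q | q.1 = 0 ∨ q.1 = 1 ∨ q.2 = 0 ∨ q.2 = 1}) ⊆
        (φ '' {q | q.2 = 0}) ∪ (φ '' {q | q.2 = 1}) ∧
      ∃ Q : ℕ → Set S,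
        (∀ m n, m ≠ n → Q m ≠ Q n) ∧
        (∀ n, ∃ z ∈ K ∩ Set.range φ, Q n = connectedComponentIn (K ∩ Set.range φ) z) ∧
        (∀ n, (Q n ∩ φ '' {q | q.2 = 0}).Nonempty ∧ (Q n ∩ φ '' {q | q.2 = 1}).Nonempty) ∧
        ∃ Qinf : Set S, IsCompact Qinf ∧ IsConnected Qinf ∧
          Filter.Tendsto (fun n => Metric.hausdorffDist (Q n) Qinf) Filter.atTop (nhds 0) ∧
          p.1 ∈ Qinf ∧ p.2 ∈ Qinf)}

/-- The collection of closed equivalence relations on `K` containing a given relation `R`. -/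
def closedEquivsOn {S : Type*} [MetricSpace S] (K : Set S) (R : Set (S × S)) :
    Set (Set (S × S)) :=
  {E | R ⊆ E ∧ E ⊆ K ×ˢ K ∧ IsClosed E ∧ (∀ x ∈ K, (x, x) ∈ E) ∧
    (∀ x y, (x, y) ∈ E → (y, x) ∈ E) ∧
    (∀ x y z, (x, y) ∈ E → (y, z) ∈ E → (x, z) ∈ E)}

/-- The Schönflies equivalence `∼_K`: the smallest closed equivalence relation on `K`
containing the Schönflies relation `R_K`. -/
def schonfliesEquiv {S : Type*} [MetricSpace S] (K : Set S) : Set (S × S) :=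
  ⋂₀ closedEquivsOn K (schonfliesRel K)

/-- The Schönflies class `[x]_∼` of a point `x`. -/
def schonfliesClass {S : Type*} [MetricSpace S] (K : Set S) (x : S) : Set S :=
  {y | (x, y) ∈ schonfliesEquiv K}

/-- The decomposition `D_K = {[x]_∼ : x ∈ K}` of `K` into Schönflies classes. -/
def schonfliesDecomp {S : Type*} [MetricSpace S] (K : Set S) : Set (Set S) :=
  {C | ∃ x ∈ K, C = schonfliesClass K x}

/-- An upper semicontinuous decomposition of `K`: a partition of `K` into nonempty closed
sets such that each element `δ` and open `U ⊇ δ` admit a relatively open `V` (a union of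
elements of the decomposition) with `δ ⊆ V ⊆ U`. -/
def IsUSCDecomp {X : Type*} [TopologicalSpace X] (K : Set X) (D : Set (Set X)) : Prop :=
  (∀ δ ∈ D, δ.Nonempty ∧ IsClosed δ ∧ δ ⊆ K) ∧
  (∀ δ ∈ D, ∀ δ' ∈ D, δ ≠ δ' → Disjoint δ δ') ∧
  ⋃₀ D = K ∧
  ∀ δ ∈ D, ∀ U : Set X, IsOpen U → δ ⊆ U →
    ∃ D' ⊆ D, (∃ W : Set X, IsOpen W ∧ ⋃₀ D' = W ∩ K) ∧ δ ⊆ ⋃₀ D' ∧ ⋃₀ D' ⊆ U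

/-- An upper semicontinuous decomposition into subcontinua. -/
def IsUSCDecompCont {X : Type*} [TopologicalSpace X] (K : Set X) (D : Set (Set X)) : Prop :=
  IsUSCDecomp K D ∧ ∀ δ ∈ D, IsConnected δ

/-- The relation on `↥K` identifying two points lying in a common element of `D`. -/
def decompRel {X : Type*} (K : Set X) (D : Set (Set X)) : K → K → Prop :=
  fun x y => ∃ δ ∈ D, (x : X) ∈ δ ∧ (y : X) ∈ δ

/-- The quotient space of the decomposition `D` of `K`, with the quotient topology. -/
abbrev DecompQuot {X : Type*} [TopologicalSpace X] (K : Set X) (D : Set (Set X)) : Type _ :=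
  Quot (decompRel K D)

/-- A topological space is a *Peano compactum* if it is compact, all of its connected
components are locally connected, and there is a metric inducing its topology for which,
for every `ε > 0`, at most finitely many connected components have diameter `> ε`. -/
def IsPeanoCompactumSp (Y : Type*) [ty : TopologicalSpace Y] : Prop :=
  CompactSpace Y ∧
  (∀ y : Y, LocallyConnectedSpace (connectedComponent y)) ∧
  ∃ m : MetricSpace Y, m.toPseudoMetricSpace.toUniformSpace.toTopologicalSpace = ty ∧
    ∀ ε : ℝ, 0 < ε →
      {C : Set Y | (∃ y : Y, C = connectedComponent y) ∧
        ε < @Metric.diam Y m.toPseudoMetricSpace C}.Finite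

/-- A compact subset `K` of a metric space is a Peano compactum with the restricted
metric iff all of its connected components are locally connected and for each `ε > 0`
only finitely many components have diameter `> ε`. -/
def IsPeanoCompactumSet {X : Type*} [MetricSpace X] (K : Set X) : Prop :=
  IsCompact K ∧
  (∀ x ∈ K, LocallyConnectedSpace (connectedComponentIn K x)) ∧
  ∀ ε : ℝ, 0 < ε →
    {C : Set X | (∃ x ∈ K, C = connectedComponentIn K x) ∧ ε < Metric.diam C}.Finite

/-- A Peano decomposition: a usc decomposition into subcontinua whose quotient space
(with the quotient topology) is a Peano compactum. -/
def IsPeanoDecomp {X : Type*} [MetricSpace X] (K : Set X) (D : Set (Set X)) : Prop :=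
  IsUSCDecompCont K D ∧ IsPeanoCompactumSp (DecompQuot K D)

/-- A decomposition `D` refines `D'` if every element of `D` is contained in an
element of `D'`. -/
def Refines {X : Type*} (D D' : Set (Set X)) : Prop :=
  ∀ δ ∈ D, ∃ δ' ∈ D', δ ⊆ δ'


section PartOne
open TopologicalSpace

lemma exists_component_separation {X : Type*} [TopologicalSpace X] [T2Space X] {A : Set X}
    (hA : IsCompact A) {b : X} (hb : b ∈ A) {L : Set X} (hL : IsClosed L)
    (h : Disjoint (connectedComponentIn A b) L) :
    ∃ G H : Set X, IsCompact G ∧ IsCompact H ∧ G ∪ H = A ∧ Disjoint G H ∧ b ∈ G ∧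
      Disjoint G L := by
  have : CompactSpace A := isCompact_iff_compactSpace.1 hA
  have h1 : ((↑) ⁻¹' L : Set A) ∩ connectedComponent (⟨b, hb⟩ : A) = ∅ := by
    rw [connectedComponentIn_eq_image hb] at h
    ext x
    simp only [mem_inter_iff, mem_preimage, mem_empty_iff_false, iff_false, not_and]
    intro hx hx'
    exact h.le_bot ⟨⟨x, hx', rfl⟩, hx⟩
  rw [connectedComponent_eq_iInter_isClopen] at h1
  have : Nonempty { s : Set A // IsClopen s ∧ (⟨b, hb⟩ : A) ∈ s } :=
    ⟨⟨univ, isClopen_univ, mem_univ _⟩⟩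
  obtain ⟨⟨s, hs, hbs⟩, hsL⟩ := (hL.preimage continuous_subtype_val).isCompact.elim_directed_family_closed
    (fun s : { s : Set A // IsClopen s ∧ (⟨b, hb⟩ : A) ∈ s } => (s : Set A))
    (fun s => s.2.1.1) h1
    (fun s t => ⟨⟨s.1 ∩ t.1, s.2.1.inter t.2.1, s.2.2, t.2.2⟩,
      inter_subset_left, inter_subset_right⟩)
  refine ⟨(↑) '' s, (↑) '' sᶜ, hs.1.isCompact.image continuous_subtype_val,
    hs.compl.1.isCompact.image continuous_subtype_val, ?_, ?_, ⟨_, hbs, rfl⟩, ?_⟩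
  · rw [← image_union, union_compl_self, image_univ, Subtype.range_coe]
  · exact (disjoint_image_iff Subtype.val_injective).2 disjoint_compl_right
  · rw [Set.disjoint_left]
    rintro _ ⟨x, hx, rfl⟩ hxL
    have : x ∈ ((↑) ⁻¹' L : Set A) ∩ s := ⟨hxL, hx⟩
    rw [hsL] at this
    exact this

variable {S : Type*} [MetricSpace S]

lemma nonemptyCompacts_preconnected_of_tendsto {C : ℕ → NonemptyCompacts S}
    {D : NonemptyCompacts S} (hC : ∀ n, IsPreconnected (C n : Set S))
    (h : Tendsto C atTop (𝓝 D)) : IsPreconnected (D : Set S) := by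
  rw [isPreconnected_closed_iff]
  intro t t' ht ht' hD hDt hDt'
  by_contra hcon
  have hd : Disjoint ((D : Set S) ∩ t) ((D : Set S) ∩ t') := by
    rw [Set.disjoint_left]
    rintro x ⟨hx, hxt⟩ ⟨-, hxt'⟩
    exact hcon ⟨x, hx, hxt, hxt'⟩
  obtain ⟨U, V, hU, hV, hUt, hVt, hUV⟩ :=
    SeparatedNhds.of_isCompact_isCompact (D.isCompact.inter_right ht) (D.isCompact.inter_right ht') hd
  have e1 := h.eventually ((NonemptyCompacts.isOpen_subsets_of_isOpen (hU.union hV)).mem_nhds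
    (show (D : Set S) ⊆ U ∪ V from fun x hx => (hD hx).elim (fun h => .inl (hUt ⟨hx, h⟩))
      (fun h => .inr (hVt ⟨hx, h⟩))))
  have e2 := h.eventually ((NonemptyCompacts.isOpen_inter_nonempty_of_isOpen hU).mem_nhds
    (show ((D : Set S) ∩ U).Nonempty from hDt.mono fun x hx => ⟨hx.1, hUt hx⟩))
  have e3 := h.eventually ((NonemptyCompacts.isOpen_inter_nonempty_of_isOpen hV).mem_nhds
    (show ((D : Set S) ∩ V).Nonempty from hDt'.mono fun x hx => ⟨hx.1, hVt hx⟩))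
  obtain ⟨n, h1, h2, h3⟩ := (e1.and (e2.and e3)).exists
  obtain ⟨x, -, hx⟩ := hC n U V hU hV h1 h2 h3
  exact hUV.le_bot hx

lemma nonemptyCompacts_mem_of_tendsto {C : ℕ → NonemptyCompacts S}
    {D : NonemptyCompacts S} {x : ℕ → S} {y : S} (hx : ∀ n, x n ∈ C n)
    (h : Tendsto C atTop (𝓝 D)) (hxy : Tendsto x atTop (𝓝 y)) : y ∈ D := by
  have h1 : Tendsto (fun n => infDist y (C n : Set S)) atTop (𝓝 (infDist y (D : Set S))) :=
    ((lipschitz_infDist_set y).continuous.tendsto D).comp h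
  have h2 : Tendsto (fun n => dist y (x n)) atTop (𝓝 0) := by
    have := (tendsto_const_nhds (x := y)).dist hxy
    rwa [dist_self] at this
  have h3 := le_of_tendsto_of_tendsto' h1 h2 (fun n => infDist_le_dist_of_mem (hx n))
  exact (D.isCompact.isClosed.mem_iff_infDist_zero D.nonempty).2 (le_antisymm h3 infDist_nonneg)

lemma nonemptyCompacts_subset_of_tendsto {C C' : ℕ → NonemptyCompacts S}
    {D D' : NonemptyCompacts S} (hCC : ∀ n, (C n : Set S) ⊆ C' n)
    (h : Tendsto C atTop (𝓝 D)) (h' : Tendsto C' atTop (𝓝 D')) : (D : Set S) ⊆ D' := by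
  intro y hy
  have h1 : Tendsto (fun n => infDist y (C n : Set S)) atTop (𝓝 (infDist y (D : Set S))) :=
    ((lipschitz_infDist_set y).continuous.tendsto D).comp h
  have h2 : Tendsto (fun n => infDist y (C' n : Set S)) atTop (𝓝 (infDist y (D' : Set S))) :=
    ((lipschitz_infDist_set y).continuous.tendsto D').comp h'
  have h3 := le_of_tendsto_of_tendsto' h2 h1
    (fun n => infDist_le_infDist_of_subset (hCC n) (C n).nonempty)
  rw [infDist_zero_of_mem hy] at h3
  exact (D'.isCompact.isClosed.mem_iff_infDist_zero D'.nonempty).2 (le_antisymm h3 infDist_nonneg)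

lemma nonemptyCompacts_subset_closed_of_tendsto {C : ℕ → NonemptyCompacts S}
    {D : NonemptyCompacts S} {F : Set S} (hF : IsClosed F) (hC : ∀ n, (C n : Set S) ⊆ F)
    (h : Tendsto C atTop (𝓝 D)) : (D : Set S) ⊆ F :=
  (NonemptyCompacts.isClosed_subsets_of_isClosed hF).mem_of_tendsto h (.of_forall hC)

lemma nonemptyCompacts_inter_closed_of_tendsto {C : ℕ → NonemptyCompacts S}
    {D : NonemptyCompacts S} {F : Set S} (hF : IsClosed F)
    (hC : ∀ n, ((C n : Set S) ∩ F).Nonempty)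
    (h : Tendsto C atTop (𝓝 D)) : ((D : Set S) ∩ F).Nonempty :=
  (NonemptyCompacts.isClosed_inter_nonempty_of_isClosed hF).mem_of_tendsto h (.of_forall hC)

end PartOne

section PartTwo

/-- Local pushing homeomorphism. -/
lemma exists_push_ball {c v : ℂ} {ρ : ℝ} (hv : dist v c < ρ) :
    ∃ h : ℂ ≃ₜ ℂ, h c = v ∧ ∀ x, x ∉ ball c ρ → h x = x := by
  have hρ : 0 < ρ := lt_of_le_of_lt dist_nonneg hv
  obtain ⟨k, hk⟩ : ∃ k : NNReal, (k : ℝ) = dist v c / ρ := ⟨Real.toNNReal (dist v c / ρ),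
    Real.coe_toNNReal _ (by positivity)⟩
  set f : ℂ → ℂ := fun x => x + (max 0 (1 - dist x c / ρ) : ℝ) • (v - c) with hf
  have hA : ApproximatesLinearOn f ((ContinuousLinearEquiv.refl ℝ ℂ : ℂ ≃L[ℝ] ℂ) : ℂ →L[ℝ] ℂ)
      univ k := by
    intro x _ y _
    have e : f x - f y - ((ContinuousLinearEquiv.refl ℝ ℂ : ℂ ≃L[ℝ] ℂ) : ℂ →L[ℝ] ℂ) (x - y)
        = (max 0 (1 - dist x c / ρ) - max 0 (1 - dist y c / ρ) : ℝ) • (v - c) := by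
      simp only [hf, sub_smul]
      simp
      ring
    rw [e, norm_smul, ← dist_eq_norm v c]
    have h1 : ‖max 0 (1 - dist x c / ρ) - max 0 (1 - dist y c / ρ)‖ ≤ dist x y / ρ := by
      rw [Real.norm_eq_abs]
      rw [max_comm 0, max_comm 0]
      refine (abs_max_sub_max_le_abs _ _ _).trans ?_
      · have : (1 - dist x c / ρ) - (1 - dist y c / ρ) = (dist y c - dist x c) / ρ := by ring
        rw [this, abs_div, abs_of_pos hρ]
        gcongr
        rw [dist_comm x y]
        exact abs_dist_sub_le _ _ _
    calc _ ≤ dist x y / ρ * dist v c := by gcongr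
      _ = _ := by rw [← dist_eq_norm x y, hk]; ring
  have hN : Subsingleton ℂ ∨ k < ‖((ContinuousLinearEquiv.refl ℝ ℂ).symm : ℂ →L[ℝ] ℂ)‖₊⁻¹ := by
    right
    have : ((ContinuousLinearEquiv.refl ℝ ℂ).symm : ℂ →L[ℝ] ℂ) = ContinuousLinearMap.id ℝ ℂ := by
      ext <;> simp
    rw [this]
    have h2 : ‖ContinuousLinearMap.id ℝ ℂ‖₊ = 1 := by
      ext; simp
    rw [h2, inv_one, ← NNReal.coe_lt_coe]
    rwa [hk, NNReal.coe_one, div_lt_one hρ]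
  refine ⟨hA.toHomeomorph f hN, ?_, ?_⟩
  · change f c = v
    simp [hf]
  · intro x hx
    change f x = x
    have : max 0 (1 - dist x c / ρ) = 0 := by
      apply max_eq_left
      rw [mem_ball, not_lt] at hx
      rw [sub_nonpos, one_le_div hρ]
      exact hx
    simp [hf, this]

/-- Homogeneity along a preconnected set. -/
lemma exists_push {U C : Set ℂ} (hU : IsOpen U) (hC : IsPreconnected C) (hCU : C ⊆ U)
    {a b : ℂ} (ha : a ∈ C) (hb : b ∈ C) :
    ∃ h : ℂ ≃ₜ ℂ, h a = b ∧ ∀ x, x ∉ U → h x = x := by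
  let r : ℂ → ℂ → Prop := fun a b => ∃ h : ℂ ≃ₜ ℂ, h a = b ∧ ∀ x, x ∉ U → h x = x
  have rsymm : ∀ a b, r a b → r b a := by
    rintro a b ⟨h, hab, hh⟩
    refine ⟨h.symm, by simp [← hab], fun x hx => ?_⟩
    rw [Homeomorph.symm_apply_eq, hh x hx]
  have rtrans : ∀ a b c, r a b → r b c → r a c := by
    rintro a b c ⟨h, hab, hh⟩ ⟨g, hbc, hg⟩
    exact ⟨h.trans g, by simp [hab, hbc], fun x hx => by simp [hh x hx, hg x hx]⟩
  have rloc : ∀ x ∈ U, ∀ᶠ y in 𝓝 x, r x y := by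
    intro x hx
    obtain ⟨ρ, hρ, hρU⟩ := Metric.isOpen_iff.1 hU x hx
    filter_upwards [ball_mem_nhds x hρ] with y hy
    obtain ⟨h, h1, h2⟩ := exists_push_ball (mem_ball.1 hy)
    exact ⟨h, h1, fun z hz => h2 z fun hz' => hz (hρU hz')⟩
  by_contra hn
  let A := {x | x ∈ U ∧ r a x}
  let B := {x | x ∈ U ∧ ¬ r a x}
  have hA : IsOpen A := by
    rw [isOpen_iff_mem_nhds]
    rintro x ⟨hx, hax⟩
    filter_upwards [hU.mem_nhds hx, rloc x hx] with y hy hxy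
    exact ⟨hy, rtrans _ _ _ hax hxy⟩
  have hB : IsOpen B := by
    rw [isOpen_iff_mem_nhds]
    rintro x ⟨hx, hax⟩
    filter_upwards [hU.mem_nhds hx, rloc x hx] with y hy hxy
    exact ⟨hy, fun h => hax (rtrans _ _ _ h (rsymm _ _ hxy))⟩
  obtain ⟨x, -, h1, h2⟩ := hC A B hA hB
    (fun x hx => by by_cases h : r a x; exacts [.inl ⟨hCU hx, h⟩, .inr ⟨hCU hx, h⟩])
    ⟨a, ha, hCU ha, ⟨Homeomorph.refl _, rfl, fun _ _ => rfl⟩⟩ ⟨b, hb, hCU hb, hn⟩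
  exact h2.2 h1.2

end PartTwo

section PartThree

lemma eq_of_int_valued {T : Set ℂ} (hT : IsPreconnected T) {k : ℂ → ℝ} (hk : Continuous k)
    (hi : ∀ x ∈ T, ∃ n : ℤ, k x = n) {x y : ℂ} (hx : x ∈ T) (hy : y ∈ T) : k x = k y := by
  have : DiscreteTopology (range ((↑) : ℤ → ℝ)) :=
    (Int.isClosedEmbedding_coe_real.isEmbedding.toHomeomorph.symm.isEmbedding).discreteTopology
  refine hT.constant_of_mapsTo (T := range ((↑) : ℤ → ℝ)) ⟨this⟩ hk.continuousOn ?_ hx hy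
  intro x hx
  obtain ⟨n, hn⟩ := hi x hx
  exact ⟨n, hn.symm⟩

lemma exists_free_component {K F₁ F₂ : Set ℂ} (hF₁ : IsCompact F₁) (hF₂ : IsCompact F₂)
    (hF : F₁ ∪ F₂ = K) (hd : Disjoint F₁ F₂)
    {sg : Set ℂ} (hsg : IsPreconnected sg) (hsgB : sg ⊆ ball 0 1)
    {A B : Set ℂ} (hA : IsPreconnected A) (hB : IsPreconnected B) (hAK : A ⊆ K) (hBK : B ⊆ K)
    (hAs : (A ∩ sphere 0 1).Nonempty) (hBs : (B ∩ sphere 0 1).Nonempty)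
    {a b : ℂ} (haA : a ∈ A) (hbB : b ∈ B) (hasg : a ∈ sg) (hbsg : b ∈ sg)
    (haF : a ∈ F₁) (hbF : b ∈ F₂) :
    ∃ v ∈ sg, v ∉ K ∧ ∃ e ∈ sphere (0 : ℂ) 1, e ∉ K ∧
      e ∈ closure (connectedComponentIn (ball (0 : ℂ) 1 \ K) v) := by
  classical
  by_contra hcon
  push Not at hcon
  have hKc : IsCompact K := hF ▸ hF₁.union hF₂
  have hO : IsOpen (ball (0 : ℂ) 1 \ K) := isOpen_ball.sdiff hKc.isClosed
  obtain ⟨f, hf0, hf1, -⟩ := exists_continuous_zero_one_of_isClosed hF₁.isClosed hF₂.isClosed hd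
  set V : Set ℂ := ⋃ v ∈ sg \ K, connectedComponentIn (ball (0 : ℂ) 1 \ K) v with hV
  have hVO : V ⊆ ball (0 : ℂ) 1 \ K :=
    iUnion₂_subset fun v _ => connectedComponentIn_subset _ _
  have hVopen : IsOpen V := isOpen_biUnion fun v _ => hO.connectedComponentIn
  have hsgV : sg \ K ⊆ V := fun v hv =>
    mem_biUnion hv (mem_connectedComponentIn ⟨hsgB hv.1, hv.2⟩)
  have hfr : frontier V ⊆ K := by
    intro y hy
    rw [hVopen.frontier_eq] at hy
    by_contra hyK
    -- a convex neighbourhood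
    obtain ⟨ε, hε, hεK⟩ := Metric.isOpen_iff.1 hKc.isClosed.isOpen_compl y hyK
    have hconv : IsPreconnected (ball y ε ∩ ball (0 : ℂ) 1) :=
      ((convex_ball y ε).inter (convex_ball 0 1)).isPreconnected
    have hsub : ball y ε ∩ ball (0 : ℂ) 1 ⊆ ball (0 : ℂ) 1 \ K :=
      fun x hx => ⟨hx.2, hεK hx.1⟩
    obtain ⟨w, hwV, hwy⟩ := Metric.mem_closure_iff.1 hy.1 ε hε
    obtain ⟨v, hv, hwv⟩ := mem_iUnion₂.1 hwV
    have hwb : w ∈ ball y ε ∩ ball (0 : ℂ) 1 := ⟨by rwa [mem_ball, dist_comm], (hVO hwV).1⟩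
    have hsub2 : ball y ε ∩ ball (0 : ℂ) 1 ⊆ connectedComponentIn (ball (0 : ℂ) 1 \ K) v := by
      rw [connectedComponentIn_eq hwv]
      exact hconv.subset_connectedComponentIn hwb hsub
    have hyc : y ∈ closedBall (0 : ℂ) 1 := by
      have := closure_mono (hVO.trans sdiff_subset) hy.1
      exact closure_ball_subset_closedBall this
    rcases (mem_closedBall.1 hyc).lt_or_eq with h | h
    · exact hy.2 (mem_biUnion hv (hsub2 ⟨mem_ball_self hε, h⟩))
    · refine hcon v hv.1 hv.2 y h hyK (closure_mono hsub2 ?_)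
      have : y ∈ closure (ball (0 : ℂ) 1) := by
        rw [closure_ball _ one_ne_zero]; exact hyc
      exact isOpen_ball.inter_closure ⟨mem_ball_self hε, this⟩
  have hfK : ∀ x ∈ K, ∃ n : ℤ, f x = n := by
    intro x hx
    rw [← hF] at hx
    rcases hx with hx | hx
    · exact ⟨0, by simpa using hf0 hx⟩
    · exact ⟨1, by simpa using hf1 hx⟩
  have hintg : ∀ t : ℝ, ((t : AddCircle (1 : ℝ)) = 0) ↔ ∃ n : ℤ, t = n := by
    intro t
    rw [AddCircle.coe_eq_zero_iff]
    constructor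
    · rintro ⟨n, hn⟩; exact ⟨n, by simpa using hn.symm⟩
    · rintro ⟨n, hn⟩; exact ⟨n, by simpa using hn.symm⟩
  let u : C(ℂ, AddCircle (1 : ℝ)) :=
    ⟨fun x => if x ∈ V then ((f x : ℝ) : AddCircle (1 : ℝ)) else 0, by
      refine Continuous.if ?_ ?_ continuous_const
      · intro x hx
        exact (hintg _).2 (hfK x (hfr hx))
      · exact (AddCircle.continuous_mk' 1).comp f.continuous⟩
  have haV : a ∉ V := fun h => (hVO h).2 (hAK haA)
  obtain ⟨g, ⟨-, hg⟩, -⟩ := (AddCircle.isCoveringMap_coe (1 : ℝ)).existsUnique_continuousMap_lifts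
    u a 0 (by simp [u, haV])
  have hgu : ∀ x, ((g x : ℝ) : AddCircle (1 : ℝ)) = u x := fun x => congrFun hg x
  have hgV : ∀ x, x ∉ V → ∃ n : ℤ, g x = n := by
    intro x hx
    rw [← hintg, hgu]
    simp [u, hx]
  have hKV : ∀ x ∈ K, x ∉ V := fun x hx h => (hVO h).2 hx
  obtain ⟨p, hpA, hps⟩ := hAs
  obtain ⟨q, hqB, hqs⟩ := hBs
  have e1 : g a = g p := eq_of_int_valued hA g.continuous (fun x hx => hgV x (hKV x (hAK hx))) haA hpA
  have e2 : g q = g b := eq_of_int_valued hB g.continuous (fun x hx => hgV x (hKV x (hBK hx))) hqB hbB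
  have e3 : g p = g q := by
    refine eq_of_int_valued (isPreconnected_sphere (E := ℂ) (by simp) 0 1) g.continuous
      (fun x hx => hgV x fun h => ?_) hps hqs
    have h1 := (hVO h).1
    rw [mem_ball] at h1
    rw [mem_sphere] at hx
    linarith
  have e4 : g a - f a = g b - f b := by
    refine eq_of_int_valued hsg (k := fun x => g x - f x) (g.continuous.sub f.continuous) ?_ hasg hbsg
    intro x hx
    by_cases hxK : x ∈ K
    · obtain ⟨n, hn⟩ := hgV x (hKV x hxK)
      obtain ⟨m, hm⟩ := hfK x hxK
      exact ⟨n - m, by simp [hn, hm]⟩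
    · rw [← hintg, AddCircle.coe_sub, hgu]
      have : x ∈ V := hsgV ⟨hx, hxK⟩
      simp [u, this]
  have h0 : f a = 0 := hf0 haF
  have h1 : f b = 1 := hf1 hbF
  rw [h0, h1] at e4
  linarith

end PartThree

section PartFour

lemma ray_inj_aux {q u u' : ℂ} (hq : ‖q‖ < 1) (hu : ‖u‖ = 1) (hu' : ‖u'‖ = 1) {ρ ρ' : ℝ}
    (hρ : 0 < ρ) (hle : ρ ≤ ρ') (h : q + ρ * (u - q) = q + ρ' * (u' - q)) :
    ρ = ρ' ∧ u = u' := by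
  have hρ' : 0 < ρ' := hρ.trans_le hle
  have hc : (ρ' : ℂ) ≠ 0 := by exact_mod_cast hρ'.ne'
  have h1 : u' = ((1 - ρ / ρ' : ℝ) : ℂ) * q + ((ρ / ρ' : ℝ) : ℂ) * u := by
    push_cast
    field_simp
    linear_combination -h
  have h2 : ρ = ρ' := by
    by_contra hne
    have hlt : ρ / ρ' < 1 := (div_lt_one hρ').2 (lt_of_le_of_ne hle hne)
    have hpos : 0 < ρ / ρ' := by positivity
    have h3 : ‖u'‖ ≤ (1 - ρ / ρ') * ‖q‖ + (ρ / ρ') * ‖u‖ := by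
      rw [h1]
      refine (norm_add_le _ _).trans ?_
      rw [norm_mul, norm_mul, Complex.norm_real, Complex.norm_real, Real.norm_of_nonneg hpos.le,
        Real.norm_of_nonneg (by linarith)]
    rw [hu, hu'] at h3
    nlinarith
  refine ⟨h2, ?_⟩
  subst h2
  have := mul_left_cancel₀ hc (add_left_cancel h)
  exact sub_left_injective this

lemma ray_inj {q u u' : ℂ} (hq : ‖q‖ < 1) (hu : ‖u‖ = 1) (hu' : ‖u'‖ = 1) {ρ ρ' : ℝ}
    (hρ : 0 < ρ) (hρ' : 0 < ρ') (h : q + ρ * (u - q) = q + ρ' * (u' - q)) :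
    ρ = ρ' ∧ u = u' := by
  rcases le_total ρ ρ' with hle | hle
  · exact ray_inj_aux hq hu hu' hρ hle h
  · obtain ⟨h1, h2⟩ := ray_inj_aux hq hu' hu hρ' hle h.symm
    exact ⟨h1.symm, h2.symm⟩

lemma ray_surj {q x : ℂ} (hq : ‖q‖ < 1) (hx : ‖x‖ ≤ 1) :
    ∃ ρ ∈ Icc (0 : ℝ) 1, ∃ u : ℂ, ‖u‖ = 1 ∧ x = q + ρ * (u - q) := by
  by_cases hxq : x = q
  · exact ⟨0, by simp, 1, by simp, by simp [hxq]⟩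
  have hd : 0 < ‖x - q‖ := norm_pos_iff.2 (sub_ne_zero.2 hxq)
  have hcont : Continuous (fun l : ℝ => ‖q + l * (x - q)‖) := by fun_prop
  have hL : (1 : ℝ) ≤ 2 / ‖x - q‖ + 1 := by
    have : 0 < 2 / ‖x - q‖ := by positivity
    linarith
  have := intermediate_value_Icc hL hcont.continuousOn
  obtain ⟨l, hl, hl1⟩ := this (show (1 : ℝ) ∈ _ by
    constructor
    · simpa using hx
    · have h1 : ‖((2 / ‖x - q‖ + 1 : ℝ) : ℂ) * (x - q)‖ = 2 + ‖x - q‖ := by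
        rw [norm_mul, Complex.norm_real, Real.norm_of_nonneg (by linarith)]
        field_simp
      have h2 := norm_sub_le_norm_add (((2 / ‖x - q‖ + 1 : ℝ) : ℂ) * (x - q)) q
      rw [h1] at h2
      have h3 : ‖((2 / ‖x - q‖ + 1 : ℝ) : ℂ) * (x - q) + q‖ = ‖q + ((2 / ‖x - q‖ + 1 : ℝ) : ℂ) * (x - q)‖ := by
        rw [add_comm]
      show 1 ≤ ‖q + ((2 / ‖x - q‖ + 1 : ℝ) : ℂ) * (x - q)‖
      rw [← h3]
      linarith [norm_nonneg q])
  have hl0 : 0 < l := by linarith [hl.1]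
  have hlc : (l : ℂ) ≠ 0 := by exact_mod_cast hl0.ne'
  refine ⟨l⁻¹, ⟨by positivity, inv_le_one_of_one_le₀ hl.1⟩, q + l * (x - q), hl1, ?_⟩
  push_cast
  field_simp
  ring

lemma circle_inj {e : ℂ} (he : ‖e‖ = 1) {θ θ' : ℝ} (h : |θ - θ'| < 2 * Real.pi)
    (h2 : e * Complex.exp (θ * Complex.I) = e * Complex.exp (θ' * Complex.I)) : θ = θ' := by
  have he0 : e ≠ 0 := by rw [← norm_ne_zero_iff, he]; norm_num
  have := mul_left_cancel₀ he0 h2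
  rw [Complex.exp_eq_exp_iff_exists_int] at this
  obtain ⟨n, hn⟩ := this
  have h3 : θ = θ' + n * (2 * Real.pi) := by
    have h4 := congrArg Complex.im hn
    simpa using h4
  have h5 : |(n : ℝ)| * (2 * Real.pi) < 1 * (2 * Real.pi) := by
    rw [one_mul]
    calc |(n : ℝ)| * (2 * Real.pi) = |θ - θ'| := by
          rw [h3, add_sub_cancel_left, abs_mul, abs_of_pos Real.two_pi_pos]
      _ < _ := h
  have h6 : |(n : ℝ)| < 1 := lt_of_mul_lt_mul_right h5 Real.two_pi_pos.le
  have h7 : |n| < 1 := by exact_mod_cast h6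
  have : n = 0 := Int.abs_lt_one_iff.1 h7
  simpa [this] using h3

lemma circle_surj {e u : ℂ} (he : ‖e‖ = 1) (hu : ‖u‖ = 1) {τ : ℝ} (hτ' : τ < Real.pi) :
    ∃ θ : ℝ, u = e * Complex.exp (θ * Complex.I) ∧
      (|θ| ≤ τ ∨ θ ∈ Icc τ (2 * Real.pi - τ)) := by
  have he0 : e ≠ 0 := by rw [← norm_ne_zero_iff, he]; norm_num
  have h1 : u = e * Complex.exp ((u / e).arg * Complex.I) := by
    have := Complex.norm_mul_exp_arg_mul_I (u / e)
    rw [norm_div, he, hu] at this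
    simp only [div_one, Complex.ofReal_one, one_mul] at this
    rw [this]; field_simp
  have h2 := Complex.arg_le_pi (u / e)
  have h3 := Complex.neg_pi_lt_arg (u / e)
  by_cases h4 : |(u / e).arg| ≤ τ
  · exact ⟨_, h1, Or.inl h4⟩
  · rw [abs_le, not_and_or, not_le, not_le] at h4
    rcases h4 with h4 | h4
    · refine ⟨(u / e).arg + 2 * Real.pi, ?_, Or.inr ⟨by linarith, by linarith⟩⟩
      push_cast
      rw [add_mul, Complex.exp_add, Complex.exp_two_pi_mul_I, mul_one]
      exact h1
    · exact ⟨_, h1, Or.inr ⟨h4.le, by linarith⟩⟩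

/-- The polar model quadrilateral around `q`, transported by a homeomorphism. -/
lemma exists_quad_of_homeo {K : Set ℂ} (hK : IsCompact K) (hKB : K ⊆ closedBall 0 1)
    (h : ℂ ≃ₜ ℂ) (hfix : ∀ x, x ∉ ball (0 : ℂ) 1 → h x = x)
    {q e : ℂ} (hq : ‖q‖ < 1) (he : ‖e‖ = 1) {η : ℝ} (hη : 0 < η) (hη1 : η < 1)
    (hfree : ∀ ρ ∈ Icc η 1, h (q + ρ * (e - q)) ∉ K) :
    ∃ ψ : I × I → ℂ, Continuous ψ ∧ Function.Injective ψ ∧ range ψ ⊆ closedBall 0 1 ∧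
      ∃ N : Set ℂ, IsCompact N ∧ N ∈ 𝓝 (h q) ∧
        N ⊆ h '' {x | ∃ ρ ∈ Icc (0 : ℝ) η, ∃ u : ℂ, ‖u‖ = 1 ∧ x = q + ρ * (u - q)} ∧
        K ⊆ range ψ ∪ N ∧ ψ '' {p | p.2 = 0} ⊆ N ∧ range ψ ∩ N ⊆ ψ '' {p | p.2 = 0} ∧
        ψ '' {p | p.2 = 1} ⊆ sphere 0 1 ∧ K ∩ sphere 0 1 ⊆ ψ '' {p | p.2 = 1} ∧
        ∀ p, (p.1 = 0 ∨ p.1 = 1) → ψ p ∉ K := by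
  have hball : ∀ x, x ∈ ball (0 : ℂ) 1 → h x ∈ ball (0 : ℂ) 1 := by
    intro x hx
    by_contra hcon
    have := h.injective (hfix _ hcon)
    rw [this] at hcon
    exact hcon hx
  have hsph : ∀ x : ℂ, ‖x‖ = 1 → h x = x := fun x hx => hfix x (by simp [hx])
  have hcb : ∀ x : ℂ, ‖x‖ ≤ 1 → ‖h x‖ ≤ 1 := by
    intro x hx
    rcases hx.lt_or_eq with h1 | h1
    · have := hball x (by simpa using h1)
      rw [mem_ball_zero_iff] at this
      exact this.le
    · rw [hsph x h1]; exact hx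
  have hcb' : ∀ x : ℂ, ‖h x‖ ≤ 1 → ‖x‖ ≤ 1 := by
    intro x hx
    by_contra hcon
    rw [hfix x (by simpa using (not_le.1 hcon).le)] at hx
    exact hcon hx
  -- choose τ
  obtain ⟨τ, hτ, hτπ, hτK⟩ : ∃ τ : ℝ, 0 < τ ∧ τ < Real.pi ∧ ∀ θ : ℝ, |θ| ≤ τ → ∀ ρ ∈ Icc η 1,
      h (q + ρ * (e * Complex.exp (θ * Complex.I) - q)) ∉ K := by
    have hc : Continuous (fun p : ℝ × ℝ =>
        h (q + p.2 * (e * Complex.exp (p.1 * Complex.I) - q))) :=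
      h.continuous.comp (by fun_prop)
    have ho : IsOpen ((fun p : ℝ × ℝ =>
        h (q + p.2 * (e * Complex.exp (p.1 * Complex.I) - q))) ⁻¹' Kᶜ) :=
      hK.isClosed.isOpen_compl.preimage hc
    have : ∀ᶠ θ : ℝ in 𝓝 (0 : ℝ), ∀ ρ ∈ Icc η 1,
        h (q + ρ * (e * Complex.exp (θ * Complex.I) - q)) ∉ K := by
      refine isCompact_Icc.eventually_forall_of_forall_eventually fun ρ hρ => ?_
      refine ho.mem_nhds ?_
      simpa using hfree ρ hρ
    obtain ⟨d, hd, hd2⟩ := Metric.eventually_nhds_iff.1 this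
    have hm : 0 < min d Real.pi := lt_min hd Real.pi_pos
    refine ⟨min d Real.pi / 2, by positivity, ?_, fun θ hθ => hd2 ?_⟩
    · linarith [min_le_right d Real.pi]
    · rw [Real.dist_eq, sub_zero]
      linarith [min_le_left d Real.pi]
  have hunit : ∀ θ : ℝ, ‖e * Complex.exp (θ * Complex.I)‖ = 1 := by
    intro θ; rw [norm_mul, he, Complex.norm_exp_ofReal_mul_I, one_mul]
  let th : I → ℝ := fun s => τ + (2 * Real.pi - 2 * τ) * s
  let rh : I → ℝ := fun t => η + (1 - η) * t
  let ψ : I × I → ℂ := fun p =>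
    h (q + (rh p.2 : ℝ) * (e * Complex.exp ((th p.1 : ℝ) * Complex.I) - q))
  have hrh : ∀ t, rh t ∈ Icc η 1 := by
    intro t
    have h0 := t.2.1
    have h1 := t.2.2
    constructor
    · have : 0 ≤ (1 - η) * (t : ℝ) := mul_nonneg (by linarith) h0
      show η ≤ η + (1 - η) * t
      linarith
    · show η + (1 - η) * (t : ℝ) ≤ 1
      nlinarith
  have hray1 : ∀ ρ : ℝ, ρ ∈ Icc (0 : ℝ) 1 → ∀ u : ℂ, ‖u‖ = 1 → ‖q + ρ * (u - q)‖ ≤ 1 := by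
    intro ρ hρ u hu
    have : q + ρ * (u - q) = ((1 - ρ : ℝ) : ℂ) * q + (ρ : ℂ) * u := by push_cast; ring
    rw [this]
    refine (norm_add_le _ _).trans ?_
    rw [norm_mul, norm_mul, Complex.norm_real, Complex.norm_real, Real.norm_of_nonneg hρ.1,
      Real.norm_of_nonneg (by linarith [hρ.2]), hu]
    nlinarith [hρ.1, hρ.2]
  refine ⟨ψ, ?_, ?_, ?_, h '' ((fun p : ℝ × ℂ => q + p.1 * (p.2 - q)) ''
    (Icc (0 : ℝ) η ×ˢ sphere (0 : ℂ) 1)), ?_, ?_, ?_, ?_, ?_, ?_, ?_, ?_, ?_⟩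
  · refine h.continuous.comp ?_
    have h1 : Continuous th := by
      show Continuous (fun s : I => τ + (2 * Real.pi - 2 * τ) * (s : ℝ))
      fun_prop
    have h2 : Continuous rh := by
      show Continuous (fun s : I => η + (1 - η) * (s : ℝ))
      fun_prop
    fun_prop
  · rintro ⟨s, t⟩ ⟨s', t'⟩ heq
    have h1 := h.injective heq
    obtain ⟨h2, h3⟩ := ray_inj hq (hunit _) (hunit _) (hη.trans_le (hrh t).1)
      (hη.trans_le (hrh t').1) h1
    have h4 : th s = th s' := by
      refine circle_inj he ?_ h3
      have : th s - th s' = (2 * Real.pi - 2 * τ) * ((s : ℝ) - s') := by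
        simp only [th]; ring
      rw [this, abs_mul, abs_of_pos (by linarith)]
      have h5 : |(s : ℝ) - s'| ≤ 1 := by
        rw [abs_le]
        constructor <;> linarith [s.2.1, s.2.2, s'.2.1, s'.2.2]
      have h6 : (2 * Real.pi - 2 * τ) * |(s : ℝ) - s'| ≤ (2 * Real.pi - 2 * τ) * 1 :=
        mul_le_mul_of_nonneg_left h5 (by linarith)
      linarith
    have h5 : (s : ℝ) = s' := by
      have : (2 * Real.pi - 2 * τ) * (s : ℝ) = (2 * Real.pi - 2 * τ) * s' := by
        simp only [th] at h4; linarith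
      exact mul_left_cancel₀ (by linarith) this
    have h6 : (t : ℝ) = t' := by
      have : (1 - η) * (t : ℝ) = (1 - η) * t' := by
        simp only [rh] at h2; linarith
      exact mul_left_cancel₀ (by linarith) this
    exact Prod.ext (Subtype.ext h5) (Subtype.ext h6)
  · rintro _ ⟨p, rfl⟩
    rw [mem_closedBall_zero_iff]
    exact hcb _ (hray1 _ ⟨hη.le.trans (hrh _).1, (hrh _).2⟩ _ (hunit _))
  · exact ((isCompact_Icc.prod (isCompact_sphere _ _)).image (by fun_prop)).image h.continuous
  · refine (h.isOpenMap.image_mem_nhds ?_)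
    have hq1 : 0 < 1 - ‖q‖ := by linarith
    refine Metric.mem_nhds_iff.2 ⟨min (1 - ‖q‖) (η * (1 - ‖q‖)), lt_min hq1 (by positivity), ?_⟩
    intro x hx
    rw [mem_ball, dist_eq_norm, lt_min_iff] at hx
    have hx1 : ‖x‖ ≤ 1 := by
      have := norm_add_le (x - q) q
      rw [sub_add_cancel] at this
      linarith [hx.1]
    obtain ⟨ρ, hρ, u, hu, hxu⟩ := ray_surj hq hx1
    refine ⟨(ρ, u), ⟨⟨hρ.1, ?_⟩, by simpa using hu⟩, hxu.symm⟩
    have h1 : ‖x - q‖ = ρ * ‖u - q‖ := by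
      rw [hxu, add_sub_cancel_left, norm_mul, Complex.norm_real, Real.norm_of_nonneg hρ.1]
    have h2 : 1 - ‖q‖ ≤ ‖u - q‖ := by
      have := norm_sub_norm_le u q
      linarith
    have h3 : ρ * (1 - ‖q‖) ≤ ρ * ‖u - q‖ := mul_le_mul_of_nonneg_left h2 hρ.1
    have h4 : ρ * (1 - ‖q‖) < η * (1 - ‖q‖) := by linarith [hx.2]
    exact (lt_of_mul_lt_mul_right h4 hq1.le).le
  · rintro _ ⟨_, ⟨⟨ρ, u⟩, ⟨hρ, hu⟩, rfl⟩, rfl⟩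
    exact ⟨_, ⟨ρ, hρ, u, by simpa using hu, rfl⟩, rfl⟩
  · intro k hk
    have hk1 : ‖h (h.symm k)‖ ≤ 1 := by simpa using hKB hk
    obtain ⟨ρ, hρ, u, hu, hx⟩ := ray_surj hq (hcb' _ hk1)
    rcases le_total ρ η with hle | hle
    · right
      exact ⟨h.symm k, ⟨(ρ, u), ⟨⟨hρ.1, hle⟩, by simpa using hu⟩, hx.symm⟩, by simp⟩
    · left
      obtain ⟨θ, hθ, hθ2⟩ := circle_surj he hu hτπ
      rcases hθ2 with hθ2 | hθ2
      · exfalso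
        apply hτK θ hθ2 ρ ⟨hle, hρ.2⟩
        rw [← hθ, ← hx]
        simpa using hk
      · have hp : 0 < 2 * Real.pi - 2 * τ := by linarith
        have hp' : 0 < 1 - η := by linarith
        refine ⟨(⟨(θ - τ) / (2 * Real.pi - 2 * τ), div_nonneg (by linarith [hθ2.1]) hp.le,
          (div_le_one hp).2 (by linarith [hθ2.2])⟩, ⟨(ρ - η) / (1 - η),
          div_nonneg (by linarith) hp'.le, (div_le_one hp').2 (by linarith [hρ.2])⟩), ?_⟩
        have e1 : τ + (2 * Real.pi - 2 * τ) * ((θ - τ) / (2 * Real.pi - 2 * τ)) = θ := by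
          rw [mul_div_cancel₀ _ hp.ne']; ring
        have e2 : η + (1 - η) * ((ρ - η) / (1 - η)) = ρ := by
          field_simp; ring
        simp only [ψ, th, rh, e1, e2]
        rw [← hθ, ← hx]
        simp
  · rintro _ ⟨⟨s, t⟩, ht, rfl⟩
    simp only [mem_ofPred_eq] at ht
    subst ht
    refine ⟨_, ⟨(η, e * Complex.exp ((th s : ℝ) * Complex.I)), ⟨⟨hη.le, le_rfl⟩, ?_⟩, rfl⟩, ?_⟩
    · simpa using hunit (th s)
    · simp [ψ, rh]
  · rintro _ ⟨⟨⟨s, t⟩, rfl⟩, _, ⟨⟨ρ, u⟩, ⟨hρ, hu⟩, rfl⟩, heq⟩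
    refine ⟨(s, t), ?_, rfl⟩
    have h1 := h.injective heq
    have hrt := hrh t
    have hu' : ‖u‖ = 1 := by simpa using hu
    simp only at h1 hρ
    have hρ0 : 0 < ρ := by
      rcases hρ.1.lt_or_eq with h2 | h2
      · exact h2
      · exfalso
        rw [← h2] at h1
        simp only [Complex.ofReal_zero, zero_mul, add_zero] at h1
        have h3 : ((rh t : ℝ) : ℂ) * (e * Complex.exp ((th s : ℝ) * Complex.I) - q) = 0 := by
          linear_combination -h1
        rcases mul_eq_zero.1 h3 with h4 | h4
        · have : rh t = 0 := by exact_mod_cast h4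
          linarith [hrt.1]
        · have h5 := hunit (th s)
          rw [sub_eq_zero.1 h4] at h5
          linarith
    obtain ⟨h2, -⟩ := ray_inj hq hu' (hunit _) hρ0 (hη.trans_le hrt.1) h1
    have h3 : (1 - η) * (t : ℝ) = 0 := by
      have h4 : (1 - η) * (t : ℝ) ≤ 0 := by
        have := hρ.2
        rw [h2] at this
        simp only [rh] at this
        linarith
      have h5 : 0 ≤ (1 - η) * (t : ℝ) := mul_nonneg (by linarith) t.2.1
      linarith
    have h6 : (t : ℝ) = 0 := (mul_eq_zero.1 h3).resolve_left (by linarith)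
    exact Subtype.ext h6
  · rintro _ ⟨⟨s, t⟩, ht, rfl⟩
    simp only [mem_ofPred_eq] at ht
    subst ht
    have : ψ (s, 1) = e * Complex.exp ((th s : ℝ) * Complex.I) := by
      simp only [ψ, rh]
      have e1 : ((η + (1 - η) * ((1 : I) : ℝ) : ℝ) : ℂ) = 1 := by simp
      rw [e1, one_mul, add_sub_cancel, hsph _ (hunit _)]
    rw [this, mem_sphere_zero_iff_norm]
    exact hunit _
  · rintro k ⟨hk, hks⟩
    have hk1 : ‖k‖ = 1 := by simpa using hks
    obtain ⟨θ, hθ, hθ2⟩ := circle_surj he hk1 hτπ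
    rcases hθ2 with hθ2 | hθ2
    · exfalso
      apply hτK θ hθ2 1 ⟨hη1.le, le_rfl⟩
      rw [← hθ]
      rw [Complex.ofReal_one, one_mul, add_sub_cancel, hsph k hk1]
      exact hk
    · have hp : 0 < 2 * Real.pi - 2 * τ := by linarith
      refine ⟨(⟨(θ - τ) / (2 * Real.pi - 2 * τ), div_nonneg (by linarith [hθ2.1]) hp.le,
          (div_le_one hp).2 (by linarith [hθ2.2])⟩, 1), rfl, ?_⟩
      have e1 : τ + (2 * Real.pi - 2 * τ) * ((θ - τ) / (2 * Real.pi - 2 * τ)) = θ := by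
        rw [mul_div_cancel₀ _ hp.ne']; ring
      have e2 : ((η + (1 - η) * ((1 : I) : ℝ) : ℝ) : ℂ) = 1 := by simp
      simp only [ψ, th, rh, e1, e2]
      rw [← hθ, one_mul, add_sub_cancel, hsph k hk1]
  · rintro ⟨s, t⟩ hs
    simp only at hs
    rcases hs with rfl | rfl
    · have := hτK τ (abs_of_pos hτ).le (rh t) (hrh t)
      simpa [ψ, th] using this
    · have := hτK (-τ) (by rw [abs_neg, abs_of_pos hτ]) (rh t) (hrh t)
      have e1 : Complex.exp ((th 1 : ℝ) * Complex.I) = Complex.exp (((-τ : ℝ) : ℂ) * Complex.I) := by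
        rw [Complex.exp_eq_exp_iff_exists_int]
        refine ⟨1, ?_⟩
        simp only [th]
        push_cast
        simp
        ring
      simp only [ψ]
      rw [e1]
      exact this

end PartFour
section PartFive

lemma exists_quad {K : Set ℂ} (hK : IsCompact K) (hKB : K ⊆ closedBall 0 1)
    {ζ : ℂ} {r : ℝ} (hr : ball ζ r ⊆ ball 0 1) {v : ℂ} (hv : v ∈ ball ζ r) (hvK : v ∉ K)
    {e : ℂ} (he : e ∈ sphere (0 : ℂ) 1) (heK : e ∉ K)
    (hcl : e ∈ closure (connectedComponentIn (ball (0 : ℂ) 1 \ K) v)) :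
    ∃ ψ : I × I → ℂ, Continuous ψ ∧ Function.Injective ψ ∧ range ψ ⊆ closedBall 0 1 ∧
      ∃ N : Set ℂ, IsCompact N ∧ N ∈ 𝓝 ζ ∧ N ⊆ ball ζ r ∧
        K ⊆ range ψ ∪ N ∧ ψ '' {p | p.2 = 0} ⊆ N ∧ range ψ ∩ N ⊆ ψ '' {p | p.2 = 0} ∧
        ψ '' {p | p.2 = 1} ⊆ sphere 0 1 ∧ K ∩ sphere 0 1 ⊆ ψ '' {p | p.2 = 1} ∧
        ∀ p, (p.1 = 0 ∨ p.1 = 1) → ψ p ∉ K := by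
  have he1 : ‖e‖ = 1 := by simpa using he
  have hO : IsOpen (ball (0 : ℂ) 1 \ K) := isOpen_ball.sdiff hK.isClosed
  set V := connectedComponentIn (ball (0 : ℂ) 1 \ K) v with hVdef
  have hvV : v ∈ V := mem_connectedComponentIn ⟨hr hv, hvK⟩
  obtain ⟨ε, hε, hεK⟩ := Metric.isOpen_iff.1 hK.isClosed.isOpen_compl e heK
  have hconv : IsPreconnected (ball e ε ∩ ball (0 : ℂ) 1) :=
    ((convex_ball e ε).inter (convex_ball 0 1)).isPreconnected
  have hsub : ball e ε ∩ ball (0 : ℂ) 1 ⊆ ball (0 : ℂ) 1 \ K :=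
    fun x hx => ⟨hx.2, hεK hx.1⟩
  obtain ⟨w0, hw0V, hw0⟩ := Metric.mem_closure_iff.1 hcl ε hε
  have hsub2 : ball e ε ∩ ball (0 : ℂ) 1 ⊆ V := by
    rw [hVdef, connectedComponentIn_eq hw0V]
    exact hconv.subset_connectedComponentIn
      ⟨by rwa [mem_ball, dist_comm], (connectedComponentIn_subset _ _ hw0V).1⟩ hsub
  obtain ⟨δ, hδ, hδε, hδ1⟩ : ∃ δ : ℝ, 0 < δ ∧ δ < ε ∧ δ < 1 := by
    refine ⟨min ε 1 / 2, ?_, ?_, ?_⟩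
    · have : 0 < min ε 1 := lt_min hε one_pos
      positivity
    · have : 0 < min ε 1 := lt_min hε one_pos
      linarith [min_le_left ε 1]
    · linarith [min_le_right ε 1]
  let x : ℝ → ℂ := fun s => ((1 - s : ℝ) : ℂ) * e
  have hxc : Continuous x := by
    show Continuous fun s : ℝ => ((1 - s : ℝ) : ℂ) * e
    fun_prop
  have hxn : ∀ s ∈ Icc 0 δ, ‖x s‖ = 1 - s := by
    intro s hs
    simp only [x]
    rw [norm_mul, he1, Complex.norm_real, Real.norm_of_nonneg (by linarith [hs.2]), mul_one]
  have hxe : ∀ s ∈ Icc 0 δ, x s ∈ ball e ε := by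
    intro s hs
    have : x s - e = ((-s : ℝ) : ℂ) * e := by simp only [x]; push_cast; ring
    rw [mem_ball, dist_eq_norm, this, norm_mul, he1, Complex.norm_real, mul_one, norm_neg,
      Real.norm_of_nonneg hs.1]
    linarith [hs.2]
  have hδm : δ ∈ Icc 0 δ := ⟨hδ.le, le_rfl⟩
  have hpV : x δ ∈ V := hsub2 ⟨hxe δ hδm, by
    rw [mem_ball_zero_iff, hxn δ hδm]; linarith⟩
  obtain ⟨h₁, h₁p, h₁f⟩ := exists_push hO isPreconnected_connectedComponentIn
    (connectedComponentIn_subset _ v) hpV hvV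
  have h₁K : ∀ y, y ∉ K → h₁ y ∉ K := by
    intro y hy hyK
    have h2 := h₁.injective (h₁f (h₁ y) fun h => h.2 hyK)
    rw [h2] at hyK
    exact hy hyK
  obtain ⟨s₀, hs₀, hmin⟩ := isCompact_Icc.exists_isMinOn (s := Icc 0 δ) ⟨δ, hδm⟩
    (f := fun s => dist (h₁ (x s)) ζ) ((h₁.continuous.comp hxc).dist continuous_const).continuousOn
  have hmin' : ∀ s ∈ Icc 0 δ, dist (h₁ (x s₀)) ζ ≤ dist (h₁ (x s)) ζ := fun s hs => hmin hs
  have hw : dist (h₁ (x s₀)) ζ < r := by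
    refine (hmin' δ hδm).trans_lt ?_
    rw [h₁p]; exact hv
  have hs₀0 : 0 < s₀ := by
    rcases hs₀.1.lt_or_eq with h | h
    · exact h
    · exfalso
      have hx0 : x s₀ = e := by simp [x, ← h]
      have heb : e ∉ ball (0 : ℂ) 1 := by simp [he1]
      rw [hx0, h₁f e (fun h => heb h.1)] at hw
      exact heb (hr hw)
  have hq : ‖x s₀‖ < 1 := by rw [hxn s₀ hs₀]; linarith
  obtain ⟨d, hd, hd2⟩ := Metric.continuousAt_iff.1 (h₁.continuous.continuousAt (x := x s₀))
    (r - dist (h₁ (x s₀)) ζ) (by linarith)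
  obtain ⟨η, hη, hη1, hηd⟩ : ∃ η : ℝ, 0 < η ∧ η < 1 ∧ 2 * η < d := by
    refine ⟨min d 1 / 4, ?_, ?_, ?_⟩
    · have : 0 < min d 1 := lt_min hd one_pos
      positivity
    · linarith [min_le_right d 1]
    · have : 0 < min d 1 := lt_min hd one_pos
      linarith [min_le_left d 1]
  have hray : ∀ ρ : ℝ, x s₀ + ρ * (e - x s₀) = x (s₀ * (1 - ρ)) := by
    intro ρ; simp only [x]; push_cast; ring
  have hmem : ∀ ρ ∈ Icc η 1, s₀ * (1 - ρ) ∈ Icc 0 δ := by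
    intro ρ hρ
    refine ⟨mul_nonneg hs₀0.le (by linarith [hρ.2]), ?_⟩
    have : s₀ * (1 - ρ) ≤ s₀ * 1 := mul_le_mul_of_nonneg_left (by linarith [hρ.1]) hs₀0.le
    linarith [hs₀.2]
  set A : Set ℂ := (fun ρ : ℝ => h₁ (x (s₀ * (1 - ρ)))) '' Icc η 1 with hA
  have hAc : IsCompact A := isCompact_Icc.image (h₁.continuous.comp (hxc.comp (by fun_prop)))
  have hU₂ : IsOpen (ball ζ r \ A) := isOpen_ball.sdiff hAc.isClosed
  have hseg : segment ℝ (h₁ (x s₀)) ζ ⊆ ball ζ r \ A := by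
    intro z hz
    refine ⟨(convex_ball ζ r).segment_subset hw (mem_ball_self (dist_nonneg.trans_lt hw)) hz, ?_⟩
    rintro ⟨ρ, hρ, hz2⟩
    simp only at hz2
    have h1 := hmin' _ (hmem ρ hρ)
    rw [hz2] at h1
    obtain ⟨a, b, ha, hb, hab, rfl⟩ := hz
    have h2 : dist (a • h₁ (x s₀) + b • ζ) ζ = a * dist (h₁ (x s₀)) ζ := by
      rw [dist_eq_norm, dist_eq_norm]
      have : a • h₁ (x s₀) + b • ζ - ζ = a • (h₁ (x s₀) - ζ) := by
        have hb' : b = 1 - a := by linarith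
        rw [hb', smul_sub, sub_smul, one_smul]; ring
      rw [this, norm_smul, Real.norm_of_nonneg ha]
    rw [h2] at h1
    have h3 : a • h₁ (x s₀) + b • ζ = h₁ (x s₀) := by
      rcases (dist_nonneg (x := h₁ (x s₀)) (y := ζ)).lt_or_eq with h4 | h4
      · have : a = 1 := by nlinarith
        have hb0 : b = 0 := by linarith
        simp [this, hb0]
      · have h5 := dist_eq_zero.1 h4.symm
        rw [h5, ← add_smul, hab, one_smul]
    rw [h3] at hz2
    have h4 := h₁.injective hz2
    have h5 := hxn _ (hmem ρ hρ)
    rw [h4, hxn _ hs₀] at h5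
    have : s₀ * ρ = 0 := by linarith
    rcases mul_eq_zero.1 this with h6 | h6
    · linarith
    · linarith [hρ.1]
  obtain ⟨h₂, h₂w, h₂f⟩ := exists_push hU₂ (convex_segment _ _).isPreconnected hseg
    (left_mem_segment ℝ _ _) (right_mem_segment ℝ _ _)
  have h₂ball : ∀ y ∈ ball ζ r, h₂ y ∈ ball ζ r := by
    intro y hy
    by_contra hcon
    have := h₂.injective (h₂f (h₂ y) fun h => hcon h.1)
    rw [this] at hcon
    exact hcon hy
  obtain ⟨ψ, hψ1, hψ2, hψ3, N, hN1, hN2, hN3, hN4⟩ := exists_quad_of_homeo hK hKB (h₁.trans h₂) (by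
      intro y hy
      have h1 : h₁ y = y := h₁f y fun h => hy h.1
      have h2 : h₂ y = y := h₂f y fun h => hy (hr h.1)
      simp [h1, h2]) hq he1 hη hη1 (by
      intro ρ hρ
      rw [hray]
      have h1 : h₂ (h₁ (x (s₀ * (1 - ρ)))) = h₁ (x (s₀ * (1 - ρ))) :=
        h₂f _ fun h => h.2 ⟨ρ, hρ, rfl⟩
      rw [Homeomorph.trans_apply, h1]
      exact h₁K _ fun h => hεK (hxe _ (hmem ρ hρ)) h)
  refine ⟨ψ, hψ1, hψ2, hψ3, N, hN1, ?_, ?_, hN4⟩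
  · rwa [Homeomorph.trans_apply, h₂w] at hN2
  · refine hN3.trans ?_
    rintro _ ⟨_, ⟨ρ, hρ, u, hu, rfl⟩, rfl⟩
    rw [Homeomorph.trans_apply]
    apply h₂ball
    have h1 : dist (x s₀ + ρ * (u - x s₀)) (x s₀) < d := by
      rw [dist_eq_norm, add_sub_cancel_left, norm_mul, Complex.norm_real,
        Real.norm_of_nonneg hρ.1]
      have h2 : ‖u - x s₀‖ ≤ 2 := by
        have := norm_sub_le u (x s₀)
        linarith
      have h3 : ρ * ‖u - x s₀‖ ≤ η * 2 := mul_le_mul hρ.2 h2 (norm_nonneg _) hη.le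
      linarith
    have h2 := hd2 h1
    rw [mem_ball]
    linarith [dist_triangle (h₁ (x s₀ + ρ * (u - x s₀))) (h₁ (x s₀)) ζ]

end PartFive
section PartSix
open TopologicalSpace

lemma isClosed_connectedComponentIn_of_isClosed {X : Type*} [TopologicalSpace X] {F : Set X}
    (hF : IsClosed F) (x : X) : IsClosed (connectedComponentIn F x) := by
  by_cases hx : x ∈ F
  · apply isClosed_of_closure_subset
    exact isPreconnected_connectedComponentIn.closure.subset_connectedComponentIn
      (subset_closure (mem_connectedComponentIn hx))
      (closure_minimal (connectedComponentIn_subset _ _) hF)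
  · rw [connectedComponentIn_eq_empty hx]; exact isClosed_empty

lemma exists_disc_map {S : Type*} [TopologicalSpace S] {φ : I × I → S}
    (hφ : Topology.IsEmbedding φ) :
    ∃ Φ : ℂ → S, Continuous Φ ∧ InjOn Φ (closedBall 0 1) ∧ Φ '' closedBall 0 1 = range φ ∧
      Φ '' sphere 0 1 = φ '' {q | q.1 = 0 ∨ q.1 = 1 ∨ q.2 = 0 ∨ q.2 = 1} := by
  set s : Set ℂ := Icc (0 : ℝ) 1 ×ℂ Icc (0 : ℝ) 1 with hs
  have hsc : IsClosed s := isClosed_Icc.reProdIm isClosed_Icc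
  have hconv : Convex ℝ s :=
    ((convex_Icc (0 : ℝ) 1).linear_preimage Complex.reLm).inter
      ((convex_Icc (0 : ℝ) 1).linear_preimage Complex.imLm)
  have hintg : (interior s).Nonempty := by
    rw [hs, Complex.interior_reProdIm, interior_Icc]
    exact ⟨⟨1 / 2, 1 / 2⟩, by constructor <;> simp <;> norm_num⟩
  have hbd : Bornology.IsBounded s :=
    (Metric.isBounded_Icc (0 : ℝ) 1).reProdIm (Metric.isBounded_Icc (0 : ℝ) 1)
  obtain ⟨e, -, he2, he3⟩ :=
    exists_homeomorph_image_interior_closure_frontier_eq_unitBall hconv hintg hbd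
  rw [hsc.closure_eq] at he2
  let g : ℂ → I × I := fun x =>
    (projIcc (0 : ℝ) 1 zero_le_one x.re, projIcc (0 : ℝ) 1 zero_le_one x.im)
  have hg : Continuous g :=
    (continuous_projIcc.comp Complex.continuous_re).prodMk
      (continuous_projIcc.comp Complex.continuous_im)
  have hgs : ∀ a b : I, g ⟨a, b⟩ = (a, b) := by
    intro a b
    simp only [g, projIcc_val]
  have hsm : ∀ x ∈ s, ∃ a b : I, x = ⟨a, b⟩ := by
    intro x hx
    exact ⟨⟨x.re, hx.1⟩, ⟨x.im, hx.2⟩, rfl⟩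
  have hms : ∀ a b : I, (⟨a, b⟩ : ℂ) ∈ s := fun a b => ⟨a.2, b.2⟩
  have hfr : ∀ a b : I, (⟨a, b⟩ : ℂ) ∈ frontier s ↔ (a = 0 ∨ a = 1 ∨ b = 0 ∨ b = 1) := by
    intro a b
    rw [hs, Complex.frontier_reProdIm, closure_Icc, frontier_Icc zero_le_one]
    have ha := a.2
    have hb := b.2
    simp only [mem_union, Complex.mem_reProdIm, ha, hb, true_and, and_true, mem_insert_iff,
      mem_singleton_iff, Subtype.ext_iff, Icc.coe_zero, Icc.coe_one]
    tauto
  refine ⟨φ ∘ g ∘ e.symm, hφ.continuous.comp (hg.comp e.symm.continuous), ?_, ?_, ?_⟩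
  · rw [← he2]
    rintro _ ⟨x, hx, rfl⟩ _ ⟨y, hy, rfl⟩ hxy
    obtain ⟨a, b, rfl⟩ := hsm x hx
    obtain ⟨c, d, rfl⟩ := hsm y hy
    simp only [Function.comp_apply, Homeomorph.symm_apply_apply, hgs] at hxy
    have := hφ.injective hxy
    simp only [Prod.mk.injEq] at this
    rw [this.1, this.2]
  · rw [← he2]
    ext y
    constructor
    · rintro ⟨_, ⟨x, hx, rfl⟩, rfl⟩
      exact ⟨_, rfl⟩
    · rintro ⟨⟨a, b⟩, rfl⟩
      exact ⟨_, ⟨⟨a, b⟩, hms a b, rfl⟩, by simp [hgs]⟩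
  · rw [← he3]
    ext y
    constructor
    · rintro ⟨_, ⟨x, hx, rfl⟩, rfl⟩
      obtain ⟨a, b, rfl⟩ := hsm x (hsc.frontier_subset hx)
      exact ⟨(a, b), (hfr a b).1 hx, by simp [hgs]⟩
    · rintro ⟨⟨a, b⟩, hab, rfl⟩
      exact ⟨_, ⟨⟨a, b⟩, (hfr a b).2 hab, rfl⟩, by simp [hgs]⟩

lemma exists_rel_near {S : Type*} [MetricSpace S] [CompactSpace S] {K : Set S}
    (hK : IsCompact K) {Φ : ℂ → S} (hΦ : Continuous Φ) (hinj : InjOn Φ (closedBall 0 1))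
    {Q : ℕ → Set S} (hQd : ∀ m n, m ≠ n → Q m ≠ Q n)
    (hQc : ∀ n, ∃ z ∈ K ∩ Φ '' closedBall 0 1, Q n = connectedComponentIn (K ∩ Φ '' closedBall 0 1) z)
    (hQs : ∀ n, (Q n ∩ Φ '' sphere 0 1).Nonempty)
    {Qinf : Set S} (hQi : IsCompact Qinf)
    (hlim : Tendsto (fun n => hausdorffDist (Q n) Qinf) atTop (𝓝 0))
    {z : S} (hz : z ∈ Qinf) (hzs : z ∉ Φ '' sphere 0 1) {ε : ℝ} (hε : 0 < ε) :
    ∃ x' ∈ K, dist x' z < ε ∧ ∃ y' ∈ Qinf ∩ Φ '' sphere 0 1, (x', y') ∈ schonfliesRel K := by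
  set B : Set S := Φ '' closedBall 0 1 with hB
  have hBc : IsCompact B := (isCompact_closedBall _ _).image hΦ
  have hKB : IsCompact (K ∩ B) := hK.inter hBc
  have hsB : Φ '' sphere 0 1 ⊆ B := image_mono sphere_subset_closedBall
  have hQeq : ∀ n, ∀ x ∈ Q n, Q n = connectedComponentIn (K ∩ B) x := by
    intro n x hx
    obtain ⟨w, hw, h⟩ := hQc n
    rw [h] at hx ⊢
    exact connectedComponentIn_eq hx
  have hQsub : ∀ n, Q n ⊆ K ∩ B := by
    intro n
    obtain ⟨w, hw, h⟩ := hQc n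
    rw [h]; exact connectedComponentIn_subset _ _
  have hQpre : ∀ n, IsPreconnected (Q n) := by
    intro n
    obtain ⟨w, hw, h⟩ := hQc n
    rw [h]; exact isPreconnected_connectedComponentIn
  have hQdis : ∀ m n x, x ∈ Q m → x ∈ Q n → m = n := by
    intro m n x hm hn
    by_contra hne
    exact hQd m n hne (by rw [hQeq m x hm, hQeq n x hn])
  have hQcl : ∀ n, IsClosed (Q n) := by
    intro n
    obtain ⟨w, hw, h⟩ := hQc n
    rw [h]; exact isClosed_connectedComponentIn_of_isClosed hKB.isClosed _
  let QN : ℕ → NonemptyCompacts S := fun n =>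
    ⟨⟨Q n, (hQcl n).isCompact⟩, (hQs n).mono inter_subset_left⟩
  let QI : NonemptyCompacts S := ⟨⟨Qinf, hQi⟩, ⟨z, hz⟩⟩
  have hQN : Tendsto QN atTop (𝓝 QI) := by
    rw [tendsto_iff_dist_tendsto_zero]
    exact hlim
  have hQIsub : Qinf ⊆ K ∩ B :=
    nonemptyCompacts_subset_closed_of_tendsto (C := QN) (D := QI) hKB.isClosed hQsub hQN
  obtain ⟨ζ, hζ, hζz⟩ := (hQIsub hz).2
  have hζ1 : ζ ∈ ball (0 : ℂ) 1 := by
    rcases (mem_closedBall.1 hζ).lt_or_eq with h | h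
    · exact h
    · exact absurd ⟨ζ, h, hζz⟩ hzs
  -- Q n hits neighbourhoods of ζ
  have hhit : ∀ N ∈ 𝓝 ζ, ∀ᶠ n in atTop, ∃ x ∈ N ∩ closedBall 0 1, Φ x ∈ Q n := by
    intro N hN
    have hLc : IsCompact (Φ '' (closedBall 0 1 \ interior N)) :=
      ((isCompact_closedBall _ _).diff isOpen_interior).image hΦ
    have hzL : z ∉ Φ '' (closedBall 0 1 \ interior N) := by
      rintro ⟨x, hx, hxz⟩
      have := hinj hx.1 hζ (hxz.trans hζz.symm)
      rw [this] at hx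
      exact hx.2 (mem_interior_iff_mem_nhds.2 hN)
    obtain ⟨ρ, hρ, hρL⟩ := Metric.isOpen_iff.1 hLc.isClosed.isOpen_compl z hzL
    have h1 : Tendsto (fun n => infDist z (QN n : Set S)) atTop (𝓝 (infDist z (QI : Set S))) :=
      ((lipschitz_infDist_set z).continuous.tendsto QI).comp hQN
    rw [show infDist z (QI : Set S) = 0 from infDist_zero_of_mem hz] at h1
    filter_upwards [h1.eventually (gt_mem_nhds hρ)] with n hn
    obtain ⟨y, hy, hzy⟩ := (infDist_lt_iff (QN n).nonempty).1 hn
    obtain ⟨x, hx, rfl⟩ := (hQsub n hy).2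
    refine ⟨x, ⟨?_, hx⟩, hy⟩
    by_contra hxN
    exact hρL (by rwa [mem_ball, dist_comm]) ⟨x, ⟨hx, fun h => hxN (interior_subset h)⟩, rfl⟩
  obtain ⟨r, hr, hrsub⟩ := Metric.isOpen_iff.1
    ((isOpen_ball (x := z) (ε := ε)).preimage hΦ |>.inter (isOpen_ball (x := (0 : ℂ)) (ε := 1))) ζ
    ⟨by rw [mem_preimage, hζz]; exact mem_ball_self hε, hζ1⟩
  have hr1 : ball ζ r ⊆ ball 0 1 := fun x hx => (hrsub hx).2
  set K' : Set ℂ := closedBall 0 1 ∩ Φ ⁻¹' K with hK'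
  have hK'c : IsCompact K' := (isCompact_closedBall _ _).inter_right (hK.isClosed.preimage hΦ)
  -- pullbacks
  have hpull : ∀ n, IsPreconnected (closedBall 0 1 ∩ Φ ⁻¹' Q n) := by
    intro n
    have hc : CompactSpace (closedBall (0 : ℂ) 1) :=
      isCompact_iff_compactSpace.1 (isCompact_closedBall _ _)
    have h1 : IsClosedEmbedding ((closedBall (0 : ℂ) 1).domRestrict Φ) :=
      Continuous.isClosedEmbedding (hΦ.comp continuous_subtype_val) (injOn_iff_injective.1 hinj)
    have h2 := (hQpre n).preimage_of_isClosedMap h1.injective h1.isClosedMap (by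
      rw [range_domRestrict]; exact fun x hx => (hQsub n hx).2)
    have h3 := h2.image Subtype.val continuous_subtype_val.continuousOn
    convert h3 using 1
    ext x
    constructor
    · rintro ⟨hx, hx2⟩
      exact ⟨⟨x, hx⟩, hx2, rfl⟩
    · rintro ⟨⟨x, hx⟩, hx2, rfl⟩
      exact ⟨hx, hx2⟩
  have hpullS : ∀ n, ((closedBall 0 1 ∩ Φ ⁻¹' Q n) ∩ sphere 0 1).Nonempty := by
    intro n
    obtain ⟨y, hy, x, hx, rfl⟩ := hQs n
    exact ⟨x, ⟨sphere_subset_closedBall hx, hy⟩, hx⟩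
  have hpullK : ∀ n, (closedBall 0 1 ∩ Φ ⁻¹' Q n) ⊆ K' := fun n x hx => ⟨hx.1, (hQsub n hx.2).1⟩
  obtain ⟨v, hv, hvK, e, he, heK, hcl⟩ : ∃ v ∈ ball ζ r, v ∉ K' ∧ ∃ e ∈ sphere (0 : ℂ) 1, e ∉ K' ∧
      e ∈ closure (connectedComponentIn (ball (0 : ℂ) 1 \ K') v) := by
    obtain ⟨n₀, hn₀⟩ := eventually_atTop.1 (hhit _ (ball_mem_nhds ζ hr))
    obtain ⟨a, ha, haQ⟩ := hn₀ n₀ le_rfl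
    obtain ⟨b, hb, hbQ⟩ := hn₀ (n₀ + 1) (by omega)
    have hdis : Disjoint (connectedComponentIn (K ∩ B) (Φ a)) {Φ b} := by
      rw [← hQeq n₀ _ haQ, disjoint_singleton_right]
      intro h
      have := hQdis _ _ _ h hbQ
      omega
    obtain ⟨G, H, hG, hH, hGH, hGHd, haG, hGL⟩ :=
      exists_component_separation hKB (hQsub _ haQ) isClosed_singleton hdis
    have hbH : Φ b ∈ H := by
      have : Φ b ∈ G ∪ H := by rw [hGH]; exact hQsub _ hbQ
      exact this.resolve_left (fun h => disjoint_singleton_right.1 hGL h)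
    refine exists_free_component (F₁ := closedBall 0 1 ∩ Φ ⁻¹' G) (F₂ := closedBall 0 1 ∩ Φ ⁻¹' H)
      ((isCompact_closedBall _ _).inter_right (hG.isClosed.preimage hΦ))
      ((isCompact_closedBall _ _).inter_right (hH.isClosed.preimage hΦ)) ?_ ?_
      (convex_ball ζ r).isPreconnected hr1 (hpull n₀) (hpull (n₀ + 1)) (hpullK _) (hpullK _)
      (hpullS _) (hpullS _) ⟨ha.2, haQ⟩ ⟨hb.2, hbQ⟩ ha.1 hb.1 ⟨ha.2, haG⟩ ⟨hb.2, hbH⟩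
    · rw [← inter_union_distrib_left, ← preimage_union, hGH]
      ext x
      constructor
      · rintro ⟨hx, hx2⟩; exact ⟨hx, hx2.1⟩
      · rintro ⟨hx, hx2⟩; exact ⟨hx, hx2, x, hx, rfl⟩
    · exact (hGHd.preimage Φ).mono inter_subset_right inter_subset_right
  obtain ⟨ψ, hψc, hψi, hψB, N, hNc, hNζ, hNr, hKN, h0N, hTN, h1s, hKs, hside⟩ :=
    exists_quad hK'c inter_subset_left hr1 hv hvK he heK hcl
  have hNB : N ⊆ closedBall 0 1 := hNr.trans (hr1.trans ball_subset_closedBall)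
  set φ : I × I → S := Φ ∘ ψ with hφ
  have hφe : Topology.IsEmbedding φ := by
    refine (Continuous.isClosedEmbedding (hΦ.comp hψc) ?_).isEmbedding
    intro p q hpq
    exact hψi (hinj (hψB ⟨p, rfl⟩) (hψB ⟨q, rfl⟩) hpq)
  have hTc : IsCompact (range φ) := isCompact_range hφe.continuous
  have hTB : range φ ⊆ B := by
    rintro _ ⟨p, rfl⟩
    exact ⟨ψ p, hψB ⟨p, rfl⟩, rfl⟩
  have hMc : IsCompact (Φ '' N) := hNc.image hΦ
  have hcov : K ∩ B ⊆ range φ ∪ Φ '' N := by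
    rintro _ ⟨hxK, x, hx, rfl⟩
    rcases hKN ⟨hx, hxK⟩ with ⟨p, rfl⟩ | h
    · exact Or.inl ⟨p, rfl⟩
    · exact Or.inr ⟨x, h, rfl⟩
  have hTM : range φ ∩ Φ '' N ⊆ φ '' {q | q.2 = 0} := by
    rintro _ ⟨⟨p, rfl⟩, x, hx, hxp⟩
    have h1 := hinj (hNB hx) (hψB ⟨p, rfl⟩) hxp
    obtain ⟨p', hp', h2⟩ := hTN ⟨⟨p, rfl⟩, h1 ▸ hx⟩
    exact ⟨p', hp', congrArg Φ h2⟩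
  have h0M : φ '' {q | q.2 = 0} ⊆ Φ '' N := by
    rw [hφ, image_comp]; exact image_mono h0N
  have h1S : φ '' {q | q.2 = 1} ⊆ Φ '' sphere 0 1 := by
    rw [hφ, image_comp]; exact image_mono h1s
  have hKS : K ∩ Φ '' sphere 0 1 ⊆ φ '' {q | q.2 = 1} := by
    rintro _ ⟨hxK, x, hx, rfl⟩
    obtain ⟨p, hp, h⟩ := hKs ⟨⟨sphere_subset_closedBall hx, hxK⟩, hx⟩
    exact ⟨p, hp, congrArg Φ h⟩
  have h0c : IsClosed (φ '' {q | q.2 = 0}) :=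
    ((isClosed_eq continuous_snd continuous_const).isCompact.image hφe.continuous).isClosed
  have h1c : IsClosed (φ '' {q | q.2 = 1}) :=
    ((isClosed_eq continuous_snd continuous_const).isCompact.image hφe.continuous).isClosed
  have hbdy : K ∩ (φ '' {q | q.1 = 0 ∨ q.1 = 1 ∨ q.2 = 0 ∨ q.2 = 1}) ⊆
        (φ '' {q | q.2 = 0}) ∪ (φ '' {q | q.2 = 1}) := by
    rintro _ ⟨hxK, p, hp, rfl⟩
    have hs : ¬ (p.1 = 0 ∨ p.1 = 1) := fun h => hside p h ⟨hψB ⟨p, rfl⟩, hxK⟩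
    rcases hp with h | h | h | h
    · exact absurd (Or.inl h) hs
    · exact absurd (Or.inr h) hs
    · exact Or.inl ⟨p, h, rfl⟩
    · exact Or.inr ⟨p, h, rfl⟩
  choose b hb using fun n => hQs n
  have hb1 : ∀ n, b n ∈ φ '' {q | q.2 = 1} := fun n => hKS ⟨(hQsub n (hb n).1).1, (hb n).2⟩
  have hKT : IsCompact (K ∩ range φ) := hK.inter hTc
  have hbT : ∀ n, b n ∈ K ∩ range φ := fun n =>
    ⟨(hQsub n (hb n).1).1, image_subset_range _ _ (hb1 n)⟩
  set P : ℕ → Set S := fun n => connectedComponentIn (K ∩ range φ) (b n) with hP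
  have hbP : ∀ n, b n ∈ P n := fun n => mem_connectedComponentIn (hbT n)
  have hPQ : ∀ n, P n ⊆ Q n := by
    intro n
    rw [hQeq n _ (hb n).1]
    exact connectedComponentIn_mono _ (inter_subset_inter_right _ hTB)
  have hPT : ∀ n, P n ⊆ K ∩ range φ := fun n => connectedComponentIn_subset _ _
  have hPcl : ∀ n, IsClosed (P n) := fun n =>
    isClosed_connectedComponentIn_of_isClosed hKT.isClosed _
  obtain ⟨n₀, hn₀⟩ := eventually_atTop.1 (hhit _ hNζ)
  have hbump : ∀ n, n₀ ≤ n → (P n ∩ φ '' {q | q.2 = 0}).Nonempty := by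
    intro n hn
    by_contra hcon
    have hdis : Disjoint (P n) (φ '' {q | q.2 = 0}) := by
      rwa [disjoint_iff_inter_eq_empty, ← not_nonempty_iff_eq_empty]
    obtain ⟨G, H, hG, hH, hGH, hGHd, hbG, hGL⟩ :=
      exists_component_separation hKT (hbT n) h0c hdis
    obtain ⟨x, hx, hxQ⟩ := hn₀ n hn
    obtain ⟨y, -, hyG, hyH⟩ := isPreconnected_closed_iff.1 (hQpre n) G (H ∪ Φ '' N) hG.isClosed
      (hH.union hMc).isClosed (by
        intro y hy
        have hyKB := hQsub n hy
        rcases hcov hyKB with h | h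
        · have : y ∈ G ∪ H := by rw [hGH]; exact ⟨hyKB.1, h⟩
          rcases this with h | h
          · exact Or.inl h
          · exact Or.inr (Or.inl h)
        · exact Or.inr (Or.inr h))
      ⟨b n, (hb n).1, hbG⟩ ⟨Φ x, hxQ, Or.inr ⟨x, hx.1, rfl⟩⟩
    rcases hyH with hyH | hyM
    · exact disjoint_left.1 hGHd hyG hyH
    · have hyT : y ∈ K ∩ range φ := by rw [← hGH]; exact Or.inl hyG
      exact disjoint_left.1 hGL hyG (hTM ⟨hyT.2, hyM⟩)
  let PN : ℕ → NonemptyCompacts S := fun k =>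
    ⟨⟨P (n₀ + k), (hPcl _).isCompact⟩, ⟨_, hbP _⟩⟩
  obtain ⟨PI, sq, hsq, hPI⟩ := CompactSpace.tendsto_subseq PN
  have hnk : Tendsto (fun k => n₀ + sq k) atTop atTop :=
    tendsto_atTop_mono (fun k => Nat.le_add_left _ _) hsq.tendsto_atTop
  have hPIQ : (PI : Set S) ⊆ Qinf :=
    nonemptyCompacts_subset_of_tendsto (C := PN ∘ sq) (C' := fun k => QN (n₀ + sq k)) (D' := QI)
      (fun k => hPQ _) hPI (hQN.comp hnk)
  obtain ⟨x', hx'P, hx'0⟩ := nonemptyCompacts_inter_closed_of_tendsto h0c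
    (C := PN ∘ sq) (fun k => hbump _ (Nat.le_add_right _ _)) hPI
  obtain ⟨y', hy'P, hy'1⟩ := nonemptyCompacts_inter_closed_of_tendsto h1c
    (C := PN ∘ sq) (fun k => ⟨_, hbP _, hb1 _⟩) hPI
  have hPIpre : IsPreconnected (PI : Set S) :=
    nonemptyCompacts_preconnected_of_tendsto (C := PN ∘ sq)
      (fun k => isPreconnected_connectedComponentIn) hPI
  refine ⟨x', (hQIsub (hPIQ hx'P)).1, ?_, y', ⟨hPIQ hy'P, h1S hy'1⟩, (hQIsub (hPIQ hx'P)).1,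
    (hQIsub (hPIQ hy'P)).1, Or.inr ⟨φ, hφe, hx'0, hy'1, hbdy, fun k => P (n₀ + sq k), ?_, ?_, ?_,
    (PI : Set S), PI.isCompact, ⟨⟨x', hx'P⟩, hPIpre⟩, ?_, hx'P, hy'P⟩⟩
  · obtain ⟨x, hx, rfl⟩ := h0M hx'0
    exact (hrsub (hNr hx)).1
  · intro m n hmn heq
    have h1 : b (n₀ + sq m) ∈ P (n₀ + sq n) := by
      have := hbP (n₀ + sq m)
      simp only at heq
      rwa [heq] at this
    have h2 := hQdis _ _ _ (hb (n₀ + sq m)).1 (hPQ _ h1)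
    exact hmn (hsq.injective (by omega))
  · exact fun k => ⟨_, hbT _, rfl⟩
  · exact fun k => ⟨hbump _ (Nat.le_add_right _ _), _, hbP _, hb1 _⟩
  · exact (tendsto_iff_dist_tendsto_zero.1 hPI)

end PartSix
section PartSeven
open TopologicalSpace

lemma schonfliesRel_subset {S : Type*} [MetricSpace S] (K : Set S) :
    schonfliesRel K ⊆ K ×ˢ K := fun _ hp => ⟨hp.1, hp.2.1⟩

lemma schonfliesEquiv_mem {S : Type*} [MetricSpace S] {K : Set S} (hK : IsClosed K) :
    schonfliesEquiv K ∈ closedEquivsOn K (schonfliesRel K) := by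
  refine ⟨?_, ?_, ?_, ?_, ?_, ?_⟩
  · exact subset_sInter fun E hE => hE.1
  · exact sInter_subset_of_mem ⟨schonfliesRel_subset K, Subset.rfl, hK.prod hK,
      fun x hx => ⟨hx, hx⟩, fun x y h => ⟨h.2, h.1⟩, fun x y z h h' => ⟨h.1, h'.2⟩⟩
  · exact isClosed_sInter fun E hE => hE.2.2.1
  · exact fun x hx E hE => hE.2.2.2.1 x hx
  · exact fun x y h E hE => hE.2.2.2.2.1 x y (h E hE)
  · exact fun x y z h hh E hE => hE.2.2.2.2.2 x y z (h E hE) (hh E hE)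

/-- Related points lie in a continuum contained in a single class. -/
lemma exists_continuum_of_rel {S : Type*} [MetricSpace S] [CompactSpace S] {K : Set S}
    (hK : IsCompact K) {x y : S} (h : (x, y) ∈ schonfliesRel K) :
    ∃ C : Set S, IsCompact C ∧ IsPreconnected C ∧ x ∈ C ∧ y ∈ C ∧ C ×ˢ C ⊆ schonfliesEquiv K := by
  obtain ⟨hRE, hEK, hEc, hrefl, hsymm, htrans⟩ := schonfliesEquiv_mem hK.isClosed
  obtain ⟨hxK, hyK, h⟩ := h
  rcases h with h | h
  · simp only at h hxK
    subst h
    refine ⟨{x}, isCompact_singleton, isPreconnected_singleton, rfl, rfl, ?_⟩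
    rintro ⟨a, b⟩ ⟨ha, hb⟩
    simp only [mem_singleton_iff] at ha hb
    rw [ha, hb]
    exact hrefl x hxK
  obtain ⟨φ, hφ, hx0, hy1, hbd, Q, hQd, hQc, hQm, Qinf, hQi, hQcon, hlim, hxQ, hyQ⟩ := h
  simp only at hxK hyK hx0 hy1 hxQ hyQ
  obtain ⟨Φ, hΦ, hinj, hΦB, hΦS⟩ := exists_disc_map hφ
  have hTc : IsCompact (range φ) := isCompact_range hφ.continuous
  have hKT : IsCompact (K ∩ range φ) := hK.inter hTc
  have hQsub : ∀ n, Q n ⊆ K ∩ range φ := by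
    intro n
    obtain ⟨w, hw, h⟩ := hQc n
    rw [h]; exact connectedComponentIn_subset _ _
  have hQcl : ∀ n, IsClosed (Q n) := by
    intro n
    obtain ⟨w, hw, h⟩ := hQc n
    rw [h]; exact isClosed_connectedComponentIn_of_isClosed hKT.isClosed _
  let QN : ℕ → NonemptyCompacts S := fun n =>
    ⟨⟨Q n, (hQcl n).isCompact⟩, (hQm n).1.mono inter_subset_left⟩
  let QI : NonemptyCompacts S := ⟨⟨Qinf, hQi⟩, ⟨x, hxQ⟩⟩
  have hQN : Tendsto QN atTop (𝓝 QI) := by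
    rw [tendsto_iff_dist_tendsto_zero]
    exact hlim
  have hQIsub : Qinf ⊆ K ∩ range φ :=
    nonemptyCompacts_subset_closed_of_tendsto (C := QN) (D := QI) hKT.isClosed hQsub hQN
  have hrel : ∀ a ∈ Qinf, ∀ b ∈ Qinf, a ∈ φ '' {q | q.2 = 0} → b ∈ φ '' {q | q.2 = 1} →
      (a, b) ∈ schonfliesEquiv K := by
    intro a ha b hb ha0 hb1
    exact hRE ⟨(hQIsub ha).1, (hQIsub hb).1, Or.inr ⟨φ, hφ, ha0, hb1, hbd, Q, hQd, hQc, hQm, Qinf,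
      hQi, hQcon, hlim, ha, hb⟩⟩
  have hxy := hrel x hxQ y hyQ hx0 hy1
  -- boundary points of the limit are equivalent to `x`
  have hbdry : ∀ w ∈ Qinf, w ∈ Φ '' sphere 0 1 → (w, x) ∈ schonfliesEquiv K := by
    intro w hw hwS
    rw [hΦS] at hwS
    rcases hbd ⟨(hQIsub hw).1, hwS⟩ with h0 | h1
    · exact htrans _ _ _ (hrel w hw y hyQ h0 hy1) (hsymm _ _ hxy)
    · exact hsymm _ _ (hrel x hxQ w hw hx0 h1)
  have hall : ∀ w ∈ Qinf, (w, x) ∈ schonfliesEquiv K := by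
    intro w hw
    by_cases hwS : w ∈ Φ '' sphere 0 1
    · exact hbdry w hw hwS
    have hQc' : ∀ n, ∃ z ∈ K ∩ Φ '' closedBall 0 1,
        Q n = connectedComponentIn (K ∩ Φ '' closedBall 0 1) z := by
      rw [hΦB]; exact hQc
    have hQs : ∀ n, (Q n ∩ Φ '' sphere 0 1).Nonempty := by
      intro n
      obtain ⟨a, ha, p, hp, rfl⟩ := (hQm n).1
      refine ⟨_, ha, ?_⟩
      rw [hΦS]
      exact ⟨p, Or.inr (Or.inr (Or.inl hp)), rfl⟩
    have hcl : (w, x) ∈ closure (schonfliesEquiv K) := by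
      rw [Metric.mem_closure_iff]
      intro ε hε
      obtain ⟨x', hx'K, hx'w, y', ⟨hy'Q, hy'S⟩, hR⟩ :=
        exists_rel_near hK hΦ hinj hQd hQc' hQs hQi hlim hw hwS hε
      refine ⟨(x', x), htrans _ _ _ (hRE hR) (hbdry y' hy'Q hy'S), ?_⟩
      rw [Prod.dist_eq, dist_self, dist_comm]
      exact max_lt hx'w hε
    rwa [hEc.closure_eq] at hcl
  refine ⟨Qinf, hQi, hQcon.isPreconnected, hxQ, hyQ, ?_⟩
  rintro ⟨a, b⟩ ⟨ha, hb⟩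
  exact htrans _ _ _ (hall a ha) (hsymm _ _ (hall b hb))

lemma exists_continuum_of_equiv {S : Type*} [MetricSpace S] [CompactSpace S] {K : Set S}
    (hK : IsCompact K) {x y : S} (h : (x, y) ∈ schonfliesEquiv K) :
    ∃ C : Set S, IsCompact C ∧ IsPreconnected C ∧ x ∈ C ∧ y ∈ C ∧ C ×ˢ C ⊆ schonfliesEquiv K := by
  obtain ⟨hRE, hEK, hEc, hrefl, hsymm, htrans⟩ := schonfliesEquiv_mem hK.isClosed
  set E' : Set (S × S) := {p | ∃ C : Set S, IsCompact C ∧ IsPreconnected C ∧ p.1 ∈ C ∧ p.2 ∈ C ∧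
    C ×ˢ C ⊆ schonfliesEquiv K} with hE'
  have hmem : E' ∈ closedEquivsOn K (schonfliesRel K) := by
    refine ⟨?_, ?_, ?_, ?_, ?_, ?_⟩
    · rintro ⟨a, b⟩ hab
      exact exists_continuum_of_rel hK hab
    · rintro ⟨a, b⟩ ⟨C, -, -, ha, hb, hC⟩
      exact hEK (hC ⟨ha, hb⟩)
    · rw [← isSeqClosed_iff_isClosed]
      intro p l hp hpl
      choose C hCc hCp hC1 hC2 hCE using hp
      let CN : ℕ → NonemptyCompacts S := fun n => ⟨⟨C n, hCc n⟩, ⟨_, hC1 n⟩⟩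
      obtain ⟨D, s, hs, hD⟩ := CompactSpace.tendsto_subseq CN
      have hps := hpl.comp hs.tendsto_atTop
      refine ⟨D, D.isCompact, nonemptyCompacts_preconnected_of_tendsto (C := CN ∘ s)
        (fun n => hCp _) hD, ?_, ?_, ?_⟩
      · exact nonemptyCompacts_mem_of_tendsto (C := CN ∘ s) (x := fun n => (p (s n)).1)
          (fun n => hC1 _) hD ((continuous_fst.tendsto l).comp hps)
      · exact nonemptyCompacts_mem_of_tendsto (C := CN ∘ s) (x := fun n => (p (s n)).2)
          (fun n => hC2 _) hD ((continuous_snd.tendsto l).comp hps)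
      · rintro ⟨a, b⟩ ⟨ha, hb⟩
        have hcl : (a, b) ∈ closure (schonfliesEquiv K) := by
          rw [Metric.mem_closure_iff]
          intro ε hε
          have key : ∀ c ∈ (D : Set S), ∀ᶠ n in atTop, ∃ c' ∈ C (s n), dist c c' < ε := by
            intro c hc
            have h1 : Tendsto (fun n => infDist c ((CN ∘ s) n : Set S)) atTop
                (𝓝 (infDist c (D : Set S))) :=
              ((lipschitz_infDist_set c).continuous.tendsto D).comp hD
            rw [infDist_zero_of_mem hc] at h1
            filter_upwards [h1.eventually (gt_mem_nhds hε)] with n hn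
            exact (infDist_lt_iff ((CN ∘ s) n).nonempty).1 hn
          obtain ⟨n, ⟨a', ha', haa⟩, b', hb', hbb⟩ := ((key a ha).and (key b hb)).exists
          refine ⟨(a', b'), hCE _ ⟨ha', hb'⟩, ?_⟩
          rw [Prod.dist_eq]
          exact max_lt haa hbb
        rwa [hEc.closure_eq] at hcl
    · intro a ha
      refine ⟨{a}, isCompact_singleton, isPreconnected_singleton, rfl, rfl, ?_⟩
      rintro ⟨b, c⟩ ⟨hb, hc⟩
      simp only [mem_singleton_iff] at hb hc
      rw [hb, hc]
      exact hrefl a ha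
    · rintro a b ⟨C, h1, h2, h3, h4, h5⟩
      exact ⟨C, h1, h2, h4, h3, h5⟩
    · rintro a b c ⟨C, h1, h2, h3, h4, h5⟩ ⟨C', h1', h2', h3', h4', h5'⟩
      simp only at h3 h4 h3' h4'
      refine ⟨C ∪ C', h1.union h1', h2.union b h4 h3' h2', Or.inl h3, Or.inr h4', ?_⟩
      have hb : ∀ d ∈ C ∪ C', (d, b) ∈ schonfliesEquiv K := by
        rintro d (hd | hd)
        · exact h5 ⟨hd, h4⟩
        · exact h5' ⟨hd, h3'⟩
      rintro ⟨d, f⟩ ⟨hd, hf⟩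
      exact htrans _ _ _ (hb d hd) (hsymm _ _ (hb f hf))
  exact h E' hmem

end PartSeven

/-- For a nonempty compact subset `K` of a closed surface `S`, the
collection `D_K` of Schönflies classes is an upper semicontinuous decomposition of `K`
into subcontinua; in particular each class is a nonempty compact connected subset of `K`. -/
theorem schonfliesDecomp_isUSCDecompIntoSubcontinua
    {S : Type*} [MetricSpace S] [CompactSpace S] [ConnectedSpace S] [Nonempty S]
    (hS : IsSurfaceLocallyEuclidean S)
    (K : Set S) (hK : IsCompact K) (hKne : K.Nonempty) :
    IsUSCDecompCont K (schonfliesDecomp K) ∧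
      ∀ x ∈ K, (schonfliesClass K x).Nonempty ∧ IsCompact (schonfliesClass K x) ∧
        IsConnected (schonfliesClass K x) ∧ schonfliesClass K x ⊆ K := by
  obtain ⟨hRE, hEK, hEc, hrefl, hsymm, htrans⟩ := schonfliesEquiv_mem hK.isClosed
  have hself : ∀ x ∈ K, x ∈ schonfliesClass K x := fun x hx => hrefl x hx
  have hclosed : ∀ x, IsClosed (schonfliesClass K x) := fun x =>
    hEc.preimage (Continuous.prodMk_right x)
  have hsub : ∀ x, schonfliesClass K x ⊆ K := fun x y hy => (hEK hy).2
  have hclass : ∀ x y, y ∈ schonfliesClass K x → schonfliesClass K x = schonfliesClass K y := by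
    intro x y hxy
    ext w
    exact ⟨fun h => htrans _ _ _ (hsymm _ _ hxy) h, fun h => htrans _ _ _ hxy h⟩
  have hconn : ∀ x ∈ K, IsConnected (schonfliesClass K x) := by
    intro x hx
    refine ⟨⟨x, hself x hx⟩, isPreconnected_of_forall x fun y hy => ?_⟩
    obtain ⟨C, -, hCp, hxC, hyC, hCE⟩ := exists_continuum_of_equiv hK hy
    exact ⟨C, fun w hw => hCE ⟨hxC, hw⟩, hxC, hyC, hCp⟩
  refine ⟨⟨⟨?_, ?_, ?_, ?_⟩, ?_⟩, fun x hx =>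
    ⟨⟨x, hself x hx⟩, (hclosed x).isCompact, hconn x hx, hsub x⟩⟩
  · rintro _ ⟨x, hx, rfl⟩
    exact ⟨⟨x, hself x hx⟩, hclosed x, hsub x⟩
  · rintro _ ⟨x, hx, rfl⟩ _ ⟨y, hy, rfl⟩ hne
    rw [disjoint_left]
    intro w hwx hwy
    exact hne ((hclass x w hwx).trans (hclass y w hwy).symm)
  · ext w
    constructor
    · rintro ⟨_, ⟨x, hx, rfl⟩, hw⟩
      exact hsub x hw
    · intro hw
      exact ⟨_, ⟨w, hw, rfl⟩, hself w hw⟩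
  · rintro _ ⟨x, hx, rfl⟩ U hU hxU
    have hcomp : IsCompact (Prod.fst '' (schonfliesEquiv K ∩ Prod.snd ⁻¹' Uᶜ)) :=
      (hEc.inter (hU.isClosed_compl.preimage continuous_snd)).isCompact.image continuous_fst
    refine ⟨{C | ∃ y ∈ K, C = schonfliesClass K y ∧ schonfliesClass K y ⊆ U}, ?_,
      ⟨(Prod.fst '' (schonfliesEquiv K ∩ Prod.snd ⁻¹' Uᶜ))ᶜ, hcomp.isClosed.isOpen_compl, ?_⟩,
      ?_, ?_⟩
    · rintro _ ⟨y, hy, rfl, -⟩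
      exact ⟨y, hy, rfl⟩
    · ext w
      constructor
      · rintro ⟨_, ⟨y, hy, rfl, hyU⟩, hw⟩
        refine ⟨?_, hsub y hw⟩
        rintro ⟨⟨a, b⟩, ⟨hab, hbU⟩, hwa⟩
        simp only at hwa
        subst hwa
        exact hbU (hyU (htrans _ _ _ hw hab))
      · rintro ⟨hw, hwK⟩
        refine ⟨_, ⟨w, hwK, rfl, fun b hb => ?_⟩, hself w hwK⟩
        by_contra hbU
        exact hw ⟨(w, b), ⟨hb, hbU⟩, rfl⟩
    · exact fun w hw => ⟨_, ⟨x, hx, rfl, hxU⟩, hw⟩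
    · rintro w ⟨_, ⟨y, hy, rfl, hyU⟩, hw⟩
      exact hyU hw
  · rintro _ ⟨x, hx, rfl⟩
    exact hconn x hx
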